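/- Let ν : V → V be the K-linear map with ν(α_i) = α_{i^*} for all i ∈ I. Then for every λ ∈ V, T_{i₁} ∘ T_{i₂} ∘ ⋯ ∘ T_{i_l}(λ) = −q^{−N} t^{h} ν(λ); that is, the braid-group operator T_{w₀} associated with the longest element acts by T_{w₀} λ = −q^{−r h^∨} t^{h} ν(λ). -/

import Mathlib

noncomputable section

open scoped BigOperators

/-- The field `K = ℚ(q,t)` of rational functions in two variables over `ℚ`. -/
abbrev KK : Type := FractionRing (MvPolynomial (Fin 2) ℚ)

/-- The variable `q` of `ℚ(q,t)`. -/
def qv : KK := algebraMap (MvPolynomial (Fin 2) ℚ) KK (MvPolynomial.X 0)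

/-- The variable `t` of `ℚ(q,t)`. -/
def tv : KK := algebraMap (MvPolynomial (Fin 2) ℚ) KK (MvPolynomial.X 1)

/-- The quantum integer `[k]_q = (q^k - q^{-k})/(q - q⁻¹)` in `ℚ(q,t)`. -/
def qint (k : ℤ) : KK := (qv ^ k - qv ^ (-k)) / (qv - qv⁻¹)

variable {I : Type}

/-- The `(q,t)`-deformed Cartan matrix `C(q,t)`:
`C_{ii} = q^{d_i} t⁻¹ + q^{-d_i} t` and `C_{ij} = [c_{ij}]_q` for `i ≠ j`. -/
def Cqt [DecidableEq I] (c : I → I → ℤ) (d : I → ℤ) (i j : I) : KK :=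
  if i = j then qv ^ (d i) * tv⁻¹ + qv ^ (-(d i)) * tv else qint (c i j)

/-- The basis vector `α_i` of `V = K^{⊕I}`. -/
def alphaK [DecidableEq I] (i : I) : I → KK := Pi.single i 1

/-- The deformed bilinear form `B` on `V`, determined by
`B(α_i, α_j) = [d_i]_q C_{ij}(q,t)`. -/
def Bform [Fintype I] [DecidableEq I] (c : I → I → ℤ) (d : I → ℤ)
    (lam mu : I → KK) : KK :=
  ∑ i, ∑ j, lam i * mu j * (qint (d i) * Cqt c d i j)

/-- The operator `T_i : V → V`, `T_i(λ) = λ - (q^{-d_i} t/[d_i]_q)·B(α_i, λ)·α_i`. -/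
def Trefl [Fintype I] [DecidableEq I] (c : I → I → ℤ) (d : I → ℤ) (i : I)
    (lam : I → KK) : I → KK :=
  fun k => lam k - (qv ^ (-(d i)) * tv / qint (d i)) * Bform c d (alphaK i) lam * alphaK i k

/-- The simple reflection `s_i` on the root lattice `ℤ^{⊕I}`, with `s_i(α_j) = α_j - c_{ij} α_i`. -/
def sZ [Fintype I] [DecidableEq I] (c : I → I → ℤ) (i : I) : (I → ℤ) → (I → ℤ) :=
  fun v k => v k - (if k = i then ∑ j, c i j * v j else 0)

/-- The simple root `α_i` of the root lattice `ℤ^{⊕I}`. -/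
def alphaZ [DecidableEq I] (i : I) : I → ℤ := Pi.single i 1

/-- Membership in the Weyl group `W`, the group of automorphisms of the root lattice
generated by the simple reflections; since each simple reflection is an involution,
`W` is exactly the set of finite products of simple reflections. -/
def memW [Fintype I] [DecidableEq I] (c : I → I → ℤ) (w : (I → ℤ) → (I → ℤ)) : Prop :=
  ∃ l : List I, w = (l.map (sZ c)).foldr (· ∘ ·) id

set_option linter.unusedSectionVars false
set_option linter.unusedSimpArgs false

/-- Hypotheses on the Cartan datum, bundled. -/
structure CH [Fintype I] [DecidableEq I] (c : I → I → ℤ) (d : I → ℤ) (r : ℤ) : Prop where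
  diag : ∀ i, c i i = 2
  off : ∀ i j, i ≠ j → c i j ≤ 0
  dpos : ∀ i, 0 < d i
  symm : ∀ i j, d i * c i j = d j * c j i
  oner : ∀ i, d i = 1 ∨ d i = r
  rmax : ∀ i, d i ≤ r
  rmem : ∃ i, d i = r
  bmax : ∀ i j, i ≠ j → c i j ≠ 0 → d i * c i j = -(max (d i) (d j))
  conn : ∀ i j : I, Relation.ReflTransGen (fun a b => a ≠ b ∧ c a b ≠ 0) i j
  wfin : {w : (I → ℤ) → (I → ℤ) | memW c w}.Finite

section lat
variable [Fintype I] [DecidableEq I] (c : I → I → ℤ) (d : I → ℤ)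

/-- coroot pairing -/
def co (i : I) : (I → ℤ) →ₗ[ℤ] ℤ where
  toFun v := ∑ j, c i j * v j
  map_add' u v := by simp [mul_add, Finset.sum_add_distrib]
  map_smul' a v := by
    simp only [Pi.smul_apply, smul_eq_mul, Finset.mul_sum, RingHom.id_apply]
    exact Finset.sum_congr rfl fun _ _ => by ring

theorem co_apply (i : I) (v : I → ℤ) : co c i v = ∑ j, c i j * v j := rfl

theorem co_alpha (i j : I) : co c i (alphaZ j) = c i j := by
  simp [co_apply, alphaZ, Pi.single_apply]

/-- simple reflection, linear -/
def sL (i : I) : Module.End ℤ (I → ℤ) where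
  toFun v := v - co c i v • alphaZ i
  map_add' u v := by simp only [map_add, add_smul]; abel
  map_smul' a v := by simp only [map_smul, smul_sub, smul_assoc, RingHom.id_apply]

theorem sL_apply (i : I) (v : I → ℤ) : sL c i v = v - co c i v • alphaZ i := rfl

theorem sL_coe (i : I) : ⇑(sL c i) = sZ c i := by
  funext v k
  by_cases h : k = i
  · subst h; simp [sL_apply, sZ, co_apply, alphaZ]
  · simp [sL_apply, sZ, alphaZ, Pi.single_apply, h]

theorem sL_apply_ne (i k : I) (h : k ≠ i) (v : I → ℤ) : sL c i v k = v k := by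
  simp [sL_apply, alphaZ, Pi.single_apply, h]

/-- product of a word -/
def SS (l : List I) : Module.End ℤ (I → ℤ) := (l.map (sL c)).prod

@[simp] theorem SS_nil : SS c [] = 1 := rfl
@[simp] theorem SS_cons (i : I) (l : List I) : SS c (i :: l) = sL c i * SS c l := by simp [SS]
@[simp] theorem SS_append (l m : List I) : SS c (l ++ m) = SS c l * SS c m := by simp [SS]

theorem SS_coe (l : List I) : ⇑(SS c l) = (l.map (sZ c)).foldr (· ∘ ·) id := by
  induction l with
  | nil => rfl
  | cons a l ih =>
    funext v
    simp only [SS_cons, Module.End.mul_apply, List.map_cons, List.foldr_cons, Function.comp_apply, ← ih, sL_coe]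

theorem vec_sum (v : I → ℤ) : v = ∑ i, v i • alphaZ i := by
  funext k
  simp [alphaZ, Pi.single_apply, Finset.sum_apply]

/-- the symmetric form -/
def Bz : LinearMap.BilinForm ℤ (I → ℤ) := Matrix.toBilin' (Matrix.of fun i j => d i * c i j)

theorem Bz_alpha_left (i : I) (v : I → ℤ) : Bz c d (alphaZ i) v = d i * co c i v := by
  simp [Bz, Matrix.toBilin'_apply, alphaZ, Pi.single_apply, co_apply, Finset.mul_sum, mul_assoc]

theorem Bz_expand (u v : I → ℤ) : Bz c d u v = ∑ i, u i * (d i * co c i v) := by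
  conv_lhs => rw [vec_sum u]
  simp only [map_sum, map_smul, LinearMap.sum_apply, LinearMap.smul_apply, smul_eq_mul, Bz_alpha_left]

end lat

namespace CH
variable [Fintype I] [DecidableEq I] {c : I → I → ℤ} {d : I → ℤ} {r : ℤ}

theorem rpos (H : CH c d r) : 0 < r := by
  obtain ⟨i, hi⟩ := H.rmem
  exact hi ▸ H.dpos i

theorem Bsymm (H : CH c d r) (u v : I → ℤ) : Bz c d u v = Bz c d v u := by
  simp only [Bz, Matrix.toBilin'_apply, Matrix.of_apply]
  rw [Finset.sum_comm]
  refine Finset.sum_congr rfl fun i _ => Finset.sum_congr rfl fun j _ => ?_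
  rw [H.symm i j]; ring

theorem Baa (H : CH c d r) (i : I) : Bz c d (alphaZ i) (alphaZ i) = 2 * d i := by
  rw [Bz_alpha_left, co_alpha, H.diag]; ring

theorem Bz_alpha_right (H : CH c d r) (i : I) (v : I → ℤ) :
    Bz c d v (alphaZ i) = d i * co c i v := by
  rw [H.Bsymm, Bz_alpha_left]

theorem s_alpha (H : CH c d r) (i : I) : sL c i (alphaZ i) = -alphaZ i := by
  rw [sL_apply, co_alpha, H.diag]; module

theorem s_invol (H : CH c d r) (i : I) (v : I → ℤ) : sL c i (sL c i v) = v := by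
  conv_lhs => rw [sL_apply c i v]
  rw [map_sub, map_smul, H.s_alpha, sL_apply]; module

theorem s_mul_self (H : CH c d r) (i : I) : sL c i * sL c i = 1 :=
  LinearMap.ext fun v => H.s_invol i v

theorem B_s (H : CH c d r) (i : I) (u v : I → ℤ) :
    Bz c d (sL c i u) (sL c i v) = Bz c d u v := by
  simp only [sL_apply, map_sub, map_smul, LinearMap.sub_apply, LinearMap.smul_apply, smul_eq_mul,
    H.Bz_alpha_right, Bz_alpha_left, co_alpha, H.diag]
  ring

theorem B_S (H : CH c d r) (l : List I) (u v : I → ℤ) :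
    Bz c d (SS c l u) (SS c l v) = Bz c d u v := by
  induction l with
  | nil => rfl
  | cons a l ih => simpa [Module.End.mul_apply, H.B_s] using ih

theorem SS_rev (H : CH c d r) (l : List I) : SS c l.reverse * SS c l = 1 := by
  induction l with
  | nil => simp
  | cons a l ih =>
    simp only [List.reverse_cons, SS_append, SS_cons, SS_nil, mul_one]
    rw [mul_assoc, ← mul_assoc (sL c a), H.s_mul_self, one_mul, ih]

theorem SS_rev' (H : CH c d r) (l : List I) : SS c l * SS c l.reverse = 1 := by
  simpa using H.SS_rev l.reverse

theorem SS_rev_apply (H : CH c d r) (l : List I) (v) : SS c l.reverse (SS c l v) = v := by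
  rw [← Module.End.mul_apply, H.SS_rev]; rfl

theorem SS_rev_apply' (H : CH c d r) (l : List I) (v) : SS c l (SS c l.reverse v) = v := by
  rw [← Module.End.mul_apply, H.SS_rev']; rfl

theorem SS_inj (H : CH c d r) (l : List I) {u v} (h : SS c l u = SS c l v) : u = v := by
  rw [← H.SS_rev_apply l u, h, H.SS_rev_apply]

/-- connectivity principle -/
theorem const_of_adj (H : CH c d r) {α : Type*} (f : I → α)
    (h : ∀ i j, i ≠ j → c i j ≠ 0 → f i = f j) (i j : I) : f i = f j := by
  induction H.conn i j with
  | refl => rfl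
  | tail _ hb ih => rw [ih]; exact h _ _ hb.1 hb.2

theorem Sfin (H : CH c d r) : {g : Module.End ℤ (I → ℤ) | ∃ l, g = SS c l}.Finite := by
  refine Set.Finite.of_finite_image (f := fun g : Module.End ℤ (I → ℤ) => (⇑g : (I → ℤ) → (I → ℤ)))
    (H.wfin.subset ?_) (fun a _ b _ h => DFunLike.coe_injective h)
  rintro _ ⟨_, ⟨l, rfl⟩, rfl⟩
  exact ⟨l, SS_coe c l⟩

theorem posdef (H : CH c d r) (v : I → ℤ) (hv : v ≠ 0) : 0 < Bz c d v v := by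
  classical
  set WF := H.Sfin.toFinset with hWF
  have memWF : ∀ g, g ∈ WF ↔ ∃ l, g = SS c l := by intro g; simp [hWF]
  let A : (I → ℤ) → (I → ℤ) → ℤ := fun x y => ∑ g ∈ WF, ∑ k, g x k * g y k
  have Ainv : ∀ i x y, A (sL c i x) (sL c i y) = A x y := by
    intro i x y
    refine Finset.sum_bij' (fun g _ => g * sL c i) (fun g _ => g * sL c i) ?_ ?_ ?_ ?_ ?_
    · intro g hg
      obtain ⟨l, rfl⟩ := (memWF g).1 hg
      exact (memWF _).2 ⟨l ++ [i], by simp⟩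
    · intro g hg
      obtain ⟨l, rfl⟩ := (memWF g).1 hg
      exact (memWF _).2 ⟨l ++ [i], by simp⟩
    · intro g _; simp [mul_assoc, H.s_mul_self]
    · intro g _; simp [mul_assoc, H.s_mul_self]
    · intro g _; simp [Module.End.mul_apply]
  have Asub : ∀ x y z, A x (y - z) = A x y - A x z := by
    intro x y z; simp [A, mul_sub, Finset.sum_sub_distrib]
  have Aneg : ∀ x y, A (-x) y = - A x y := by
    intro x y; simp [A, Finset.sum_neg_distrib]
  have Asmul : ∀ x y (a : ℤ), A x (a • y) = a * A x y := by
    intro x y a; simp only [A, Finset.mul_sum, map_smul, Pi.smul_apply, smul_eq_mul]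
    exact Finset.sum_congr rfl fun _ _ => Finset.sum_congr rfl fun _ _ => by ring
  have Asymm : ∀ x y, A x y = A y x := by
    intro x y; simp only [A]
    exact Finset.sum_congr rfl fun _ _ => Finset.sum_congr rfl fun _ _ => by ring
  have key : ∀ i y, 2 * A (alphaZ i) y = co c i y * A (alphaZ i) (alphaZ i) := by
    intro i y
    have := Ainv i (alphaZ i) y
    rw [H.s_alpha, Aneg, sL_apply, Asub, Asmul] at this
    linarith
  have Apos : ∀ x, x ≠ 0 → 0 < A x x := by
    intro x hx
    obtain ⟨k, hk⟩ := Function.ne_iff.1 hx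
    have h1 : (1 : Module.End ℤ (I → ℤ)) ∈ WF := (memWF _).2 ⟨[], rfl⟩
    refine Finset.sum_pos' (s := WF) (fun g _ => Finset.sum_nonneg fun k _ => mul_self_nonneg _) ⟨1, h1, ?_⟩
    exact Finset.sum_pos' (fun k _ => mul_self_nonneg _) ⟨k, Finset.mem_univ _, by
      simpa using mul_self_pos.2 hk⟩
  have Asum : ∀ x y, A x y = ∑ i, x i * A (alphaZ i) y := by
    intro x y
    simp only [A, Finset.mul_sum]
    conv_rhs => rw [Finset.sum_comm]
    refine Finset.sum_congr rfl fun g _ => ?_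
    conv_rhs => rw [Finset.sum_comm]
    refine Finset.sum_congr rfl fun k _ => ?_
    conv_lhs => rw [vec_sum x]
    simp only [map_sum, map_smul, Finset.sum_apply, Pi.smul_apply, smul_eq_mul, Finset.sum_mul, mul_assoc]
  have adj : ∀ i j, i ≠ j → c i j ≠ 0 →
      A (alphaZ i) (alphaZ i) / (d i : ℚ) = A (alphaZ j) (alphaZ j) / (d j : ℚ) := by
    intro i j _ hc
    have h1 := key i (alphaZ j)
    have h2 := key j (alphaZ i)
    rw [Asymm (alphaZ j), h1, co_alpha, co_alpha] at h2
    have h3 := H.symm i j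
    have hi := H.dpos i
    have hj := H.dpos j
    have : A (alphaZ i) (alphaZ i) * d j = A (alphaZ j) (alphaZ j) * d i := by
      have : c i j * (A (alphaZ i) (alphaZ i) * d j) = c i j * (A (alphaZ j) (alphaZ j) * d i) := by
        linear_combination d j * h2 - A (alphaZ j) (alphaZ j) * h3
      exact mul_left_cancel₀ hc this
    rw [div_eq_div_iff (by exact_mod_cast hi.ne') (by exact_mod_cast hj.ne')]
    exact_mod_cast this
  obtain ⟨j, hj⟩ := Function.ne_iff.1 hv
  have hall : ∀ i, A (alphaZ i) (alphaZ i) * d j = A (alphaZ j) (alphaZ j) * d i := by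
    intro i
    have := H.const_of_adj _ adj i j
    rw [div_eq_div_iff (by exact_mod_cast (H.dpos i).ne') (by exact_mod_cast (H.dpos j).ne')] at this
    exact_mod_cast this
  have haj : 0 < A (alphaZ j) (alphaZ j) := Apos _ (by simp [alphaZ])
  have : A (alphaZ j) (alphaZ j) * Bz c d v v = 2 * d j * A v v := by
    rw [Bz_expand, Asum v v, Finset.mul_sum, Finset.mul_sum]
    refine Finset.sum_congr rfl fun i _ => ?_
    linear_combination (-(d j * v i)) * key i v - v i * co c i v * hall i
  have h2 : 0 < 2 * d j * A v v := mul_pos (by have := H.dpos j; omega) (Apos v hv)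
  rw [← this] at h2
  exact (mul_pos_iff_of_pos_left haj).1 h2

end CH

/-- roots -/
def IsRt [Fintype I] [DecidableEq I] (c : I → I → ℤ) (v : I → ℤ) : Prop :=
  ∃ l i, v = SS c l (alphaZ i)

namespace CH
variable [Fintype I] [DecidableEq I] {c : I → I → ℤ} {d : I → ℤ} {r : ℤ}

theorem alpha_nonneg (i : I) : 0 ≤ (alphaZ i : I → ℤ) := by
  intro k; simp only [alphaZ, Pi.single_apply, Pi.zero_apply]; split_ifs <;> norm_num

theorem alpha_ne (i : I) : (alphaZ i : I → ℤ) ≠ 0 := by simp [alphaZ]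

theorem rt_alpha (i : I) : IsRt c (alphaZ i) := ⟨[], i, rfl⟩

theorem rt_S {v : I → ℤ} (h : IsRt c v) (l : List I) : IsRt c (SS c l v) := by
  obtain ⟨m, i, rfl⟩ := h
  exact ⟨l ++ m, i, by simp⟩

theorem rt_s {v : I → ℤ} (h : IsRt c v) (i : I) : IsRt c (sL c i v) := by
  simpa using rt_S h [i]

theorem rt_neg (H : CH c d r) {v : I → ℤ} (h : IsRt c v) : IsRt c (-v) := by
  obtain ⟨m, i, rfl⟩ := h
  exact ⟨m ++ [i], i, by simp [H.s_alpha]⟩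

theorem rt_ne (H : CH c d r) {v : I → ℤ} (h : IsRt c v) : v ≠ 0 := by
  obtain ⟨m, i, rfl⟩ := h
  intro h0
  rw [← map_zero (SS c m)] at h0
  exact alpha_ne i (H.SS_inj m h0)

theorem B_even (m : ℤ) (H : CH c d r) (v : I → ℤ) (hv : ∀ k, m ∣ d k * v k) :
    2 * m ∣ Bz c d v v := by
  have key : ∀ s : Finset I, 2 * m ∣ Bz c d (∑ k ∈ s, v k • alphaZ k) (∑ k ∈ s, v k • alphaZ k) := by
    intro s
    induction s using Finset.induction_on with
    | empty => simp
    | insert a s ha ih =>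
      rw [Finset.sum_insert ha]
      set w := ∑ k ∈ s, v k • (alphaZ k : I → ℤ)
      have : Bz c d (v a • alphaZ a + w) (v a • alphaZ a + w)
          = 2 * (d a * v a) * v a + 2 * (d a * v a) * co c a w + Bz c d w w := by
        simp only [map_add, map_smul, LinearMap.add_apply, LinearMap.smul_apply, smul_eq_mul,
          H.Bz_alpha_right, Bz_alpha_left, co_alpha, H.diag]
        ring
      rw [this]
      have h2 : 2 * m ∣ 2 * (d a * v a) := mul_dvd_mul_left 2 (hv a)
      exact dvd_add (dvd_add (h2.mul_right _) (h2.mul_right _)) ih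
  have := key Finset.univ
  rwa [← vec_sum v] at this

theorem rt_div (H : CH c d r) (l : List I) (i k : I) : d i ∣ d k * SS c l (alphaZ i) k := by
  induction l generalizing k with
  | nil =>
    by_cases h : k = i
    · subst h; simp [alphaZ]
    · simp [alphaZ, Pi.single_apply, h]
  | cons a l ih =>
    rw [SS_cons, Module.End.mul_apply]
    by_cases h : k = a
    · subst h
      have : d k * (sL c k) ((SS c l) (alphaZ i)) k = d k * SS c l (alphaZ i) k
          - ∑ j, c j k * (d j * SS c l (alphaZ i) j) := by
        simp only [sL_apply, Pi.sub_apply, Pi.smul_apply, alphaZ, Pi.single_eq_same, smul_eq_mul, co_apply, mul_sub,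
          mul_one, Finset.mul_sum]
        congr 1
        refine Finset.sum_congr rfl fun j _ => ?_
        linear_combination SS c l (Pi.single i 1) j * H.symm k j
      rw [this]
      exact dvd_sub (ih k) (Finset.dvd_sum fun j _ => (ih j).mul_left _)
    · rw [sL_apply_ne c a k h]; exact ih k

theorem rt_dich (H : CH c d r) {v : I → ℤ} (h : IsRt c v) : 0 ≤ v ∨ v ≤ 0 := by
  obtain ⟨l, i, hv⟩ := h
  have hB : Bz c d v v = 2 * d i := by rw [hv, H.B_S, H.Baa]
  have hdv : ∀ k, d i ∣ d k * v k := fun k => hv ▸ H.rt_div l i k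
  let p : I → ℤ := fun k => max (v k) 0
  let n : I → ℤ := fun k => max (-v k) 0
  have hpn : v = p - n := by
    funext k; simp only [p, n, Pi.sub_apply]; omega
  have hp0 : ∀ k, 0 ≤ p k := fun k => le_max_right _ _
  have hn0 : ∀ k, 0 ≤ n k := fun k => le_max_right _ _
  have hpn0 : ∀ k, p k * n k = 0 := by
    intro k; simp only [p, n]
    rcases le_total (v k) 0 with h | h
    · simp [h]
    · rw [max_eq_right (a := -v k) (by omega)]; simp
  by_contra hcon
  push Not at hcon
  have hpne : p ≠ 0 := by
    intro h0
    apply hcon.2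
    intro k
    have : p k = 0 := congrFun h0 k
    simp only [p] at this
    simp only [Pi.zero_apply]; omega
  have hnne : n ≠ 0 := by
    intro h0
    apply hcon.1
    intro k
    have : n k = 0 := congrFun h0 k
    simp only [n] at this
    simp only [Pi.zero_apply]; omega
  have hdp : ∀ k, d i ∣ d k * p k := by
    intro k; simp only [p]
    rcases max_choice (v k) 0 with h | h <;> rw [h]
    · exact hdv k
    · simp
  have hdn : ∀ k, d i ∣ d k * n k := by
    intro k; simp only [n]
    rcases max_choice (-v k) 0 with h | h <;> rw [h]
    · simpa using hdv k
    · simp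
  have hle1 : 2 * d i ≤ Bz c d p p := Int.le_of_dvd (H.posdef p hpne) (B_even _ H p hdp)
  have hle2 : 2 * d i ≤ Bz c d n n := Int.le_of_dvd (H.posdef n hnne) (B_even _ H n hdn)
  have hcross : Bz c d p n ≤ 0 := by
    rw [Bz_expand]
    refine Finset.sum_nonpos fun a _ => ?_
    rw [co_apply, Finset.mul_sum, Finset.mul_sum]
    refine Finset.sum_nonpos fun b _ => ?_
    by_cases hab : a = b
    · subst hab
      have : p a * (d a * (c a a * n a)) = d a * c a a * (p a * n a) := by ring
      rw [this, hpn0]; simp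
    · have h1 := H.off a b hab
      have h2 := mul_nonneg (mul_nonneg (hp0 a) (hn0 b)) (H.dpos a).le
      nlinarith [mul_nonneg h2 (neg_nonneg.2 h1)]
  have hsy := H.Bsymm n p
  rw [hpn] at hB
  simp only [map_sub, LinearMap.sub_apply] at hB
  have := H.dpos i
  linarith

theorem rt_not_both (H : CH c d r) {v : I → ℤ} (h : IsRt c v) (h1 : 0 ≤ v) (h2 : v ≤ 0) : False :=
  H.rt_ne h (le_antisymm h2 h1)

theorem s_pos (H : CH c d r) {v : I → ℤ} (h : IsRt c v) (h0 : 0 ≤ v) (i : I) (hne : v ≠ alphaZ i) :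
    0 ≤ sL c i v := by
  rcases H.rt_dich (rt_s h i) with h1 | h1
  · exact h1
  · exfalso
    have hk : ∀ k, k ≠ i → v k = 0 := fun k hk =>
      le_antisymm (by have := h1 k; rwa [sL_apply_ne c i k hk] at this) (h0 k)
    have hv : v = v i • alphaZ i := by
      funext k
      by_cases hki : k = i
      · subst hki; simp [alphaZ]
      · simp [alphaZ, Pi.single_apply, hki, hk k hki]
    obtain ⟨l, j, hl⟩ := h
    have e : alphaZ j = v i • SS c l.reverse (alphaZ i) := by
      rw [← map_smul, ← hv, hl, H.SS_rev_apply]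
    have e2 := congrFun e j
    simp only [alphaZ, Pi.single_eq_same, Pi.smul_apply, smul_eq_mul] at e2
    have : v i = 1 := by
      rcases Int.isUnit_iff.1 (IsUnit.of_mul_eq_one _ e2.symm) with h | h
      · exact h
      · have := h0 i; simp only [Pi.zero_apply] at this; omega
    rw [this, one_smul] at hv
    exact hne hv

theorem rt_fin (H : CH c d r) : {v | IsRt c v}.Finite := by
  refine ((H.Sfin.prod (Set.finite_univ (α := I))).image
    (fun p : Module.End ℤ (I → ℤ) × I => p.1 (alphaZ p.2))).subset ?_
  rintro v ⟨l, i, rfl⟩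
  exact ⟨(SS c l, i), ⟨⟨l, rfl⟩, Set.mem_univ _⟩, rfl⟩

/-- reflection conjugation -/
theorem conj (H : CH c d r) (l : List I) (i j : I) (h : SS c l (alphaZ j) = alphaZ i) :
    sL c i * SS c l = SS c l * sL c j := by
  have hd : d i = d j := by
    have := H.B_S l (alphaZ j) (alphaZ j)
    rw [h, H.Baa, H.Baa] at this; omega
  refine LinearMap.ext fun v => ?_
  have h1 := H.B_S l (alphaZ j) v
  rw [h, Bz_alpha_left, Bz_alpha_left, hd] at h1
  have h2 := mul_left_cancel₀ (H.dpos j).ne' h1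
  simp only [Module.End.mul_apply, sL_apply, map_sub, map_smul, h, h2]

theorem exists_split (H : CH c d r) (l : List I) {v : I → ℤ} (hv : IsRt c v) (h0 : 0 ≤ v)
    (hl : SS c l.reverse v ≤ 0) :
    ∃ a j b, l = a ++ j :: b ∧ SS c a.reverse v = alphaZ j := by
  induction l generalizing v with
  | nil => exact (H.rt_not_both hv h0 (by simpa using hl)).elim
  | cons x m ih =>
    by_cases hx : v = alphaZ x
    · exact ⟨[], x, m, rfl, by simpa using hx⟩
    · obtain ⟨a, j, b, hm, ha⟩ := ih (rt_s hv x) (H.s_pos hv h0 x hx) (by simpa using hl)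
      exact ⟨x :: a, j, b, by simp [hm], by simpa using ha⟩

theorem exchange (H : CH c d r) (l : List I) (i : I) (hl : SS c l.reverse (alphaZ i) ≤ 0) :
    ∃ l', l'.length < l.length ∧ SS c l' = SS c (i :: l) := by
  obtain ⟨a, j, b, rfl, ha⟩ := H.exists_split l (rt_alpha i) (alpha_nonneg i) hl
  refine ⟨a ++ b, by simp, ?_⟩
  have h1 : SS c a (alphaZ j) = alphaZ i := by rw [← ha, H.SS_rev_apply']
  have h2 := H.conj a i j h1
  simp only [SS_append, SS_cons]
  rw [← mul_assoc, h2, mul_assoc, ← mul_assoc (sL c j), H.s_mul_self, one_mul]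

end CH

/-- reducedness of a word, in terms of positivity -/
def Red [Fintype I] [DecidableEq I] (c : I → I → ℤ) : List I → Prop
  | [] => True
  | i :: l => Red c l ∧ 0 ≤ SS c l.reverse (alphaZ i)

namespace CH
variable [Fintype I] [DecidableEq I] {c : I → I → ℤ} {d : I → ℤ} {r : ℤ}

theorem shorter (H : CH c d r) (l : List I) (h : ¬ Red c l) :
    ∃ l', l'.length < l.length ∧ SS c l' = SS c l := by
  induction l with
  | nil => exact (h trivial).elim
  | cons i l ih =>
    by_cases hl : Red c l
    · have h2 : ¬ 0 ≤ SS c l.reverse (alphaZ i) := fun h' => h ⟨hl, h'⟩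
      have h3 := (H.rt_dich (rt_S (rt_alpha i) l.reverse)).resolve_left h2
      obtain ⟨l', h4, h5⟩ := H.exchange l i h3
      exact ⟨l', by simp; omega, h5⟩
    · obtain ⟨l', h4, h5⟩ := ih hl
      exact ⟨i :: l', by simpa using h4, by simp [h5]⟩

theorem exists_red (H : CH c d r) (l : List I) : ∃ l', Red c l' ∧ SS c l' = SS c l := by
  induction hn : l.length using Nat.strong_induction_on generalizing l with
  | _ n ih =>
    by_cases h : Red c l
    · exact ⟨l, h, rfl⟩
    · obtain ⟨l', h1, h2⟩ := H.shorter l h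
      obtain ⟨l'', h3, h4⟩ := ih _ (hn ▸ h1) l' rfl
      exact ⟨l'', h3, h4.trans h2⟩

open Classical in
/-- positive roots -/
def PhiP (H : CH c d r) : Finset (I → ℤ) := H.rt_fin.toFinset.filter (fun v => 0 ≤ v)

theorem mem_PhiP (H : CH c d r) (v : I → ℤ) : v ∈ H.PhiP ↔ IsRt c v ∧ 0 ≤ v := by
  simp [PhiP]

open Classical in
theorem red_sum (H : CH c d r) (f : (I → ℤ) → ℤ) (hf : ∀ i v, f (sL c i v) = f v)
    (l : List I) (hl : Red c l) :
    (l.map (fun i => f (alphaZ i))).sum = ∑ v ∈ H.PhiP.filter (fun v => SS c l.reverse v ≤ 0), f v := by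
  induction l with
  | nil =>
    rw [Finset.filter_eq_empty_iff.2]
    · simp
    · intro v hv h
      have := (H.mem_PhiP v).1 hv
      exact H.rt_not_both this.1 this.2 (by simpa using h)
  | cons i l ih =>
    have e : H.PhiP.filter (fun v => SS c (i :: l).reverse v ≤ 0)
        = insert (alphaZ i) ((H.PhiP.filter (fun v => SS c l.reverse v ≤ 0)).image (sL c i)) := by
      ext v
      simp only [Finset.mem_filter, Finset.mem_insert, Finset.mem_image, mem_PhiP, List.reverse_cons,
        SS_append, SS_cons, SS_nil, mul_one, Module.End.mul_apply]
      constructor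
      · rintro ⟨⟨h1, h2⟩, h3⟩
        by_cases hv : v = alphaZ i
        · exact Or.inl hv
        · exact Or.inr ⟨sL c i v, ⟨⟨rt_s h1 i, H.s_pos h1 h2 i hv⟩, h3⟩, H.s_invol i v⟩
      · rintro (rfl | ⟨w, ⟨⟨h1, h2⟩, h3⟩, rfl⟩)
        · refine ⟨⟨rt_alpha i, alpha_nonneg i⟩, ?_⟩
          rw [H.s_alpha, map_neg]
          exact neg_nonpos.2 hl.2
        · have hw : w ≠ alphaZ i := by
            rintro rfl
            exact H.rt_not_both (rt_S (rt_alpha i) _) hl.2 h3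
          exact ⟨⟨rt_s h1 i, H.s_pos h1 h2 i hw⟩, by rwa [H.s_invol]⟩
    rw [e, Finset.sum_insert, Finset.sum_image, List.map_cons, List.sum_cons, ih hl.1]
    · simp only [hf]
    · intro a _ b _ hab
      rw [← H.s_invol i a, hab, H.s_invol]
    · intro hm
      simp only [Finset.mem_image, Finset.mem_filter, mem_PhiP] at hm
      obtain ⟨w, ⟨⟨_, h2⟩, _⟩, h⟩ := hm
      have : w = -alphaZ i := by rw [← H.s_invol i w, h, H.s_alpha]
      have h3 := h2 i
      simp [this, alphaZ] at h3

theorem red_length (H : CH c d r) (l m : List I) (hl : Red c l) (hm : Red c m)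
    (h : SS c l = SS c m) : l.length = m.length := by
  have h1 := H.red_sum (fun _ => 1) (fun _ _ => rfl) l hl
  have h2 := H.red_sum (fun _ => 1) (fun _ _ => rfl) m hm
  have h3 : SS c l.reverse = SS c m.reverse := by
    rw [← mul_one (SS c l.reverse), ← H.SS_rev' m, ← h, ← mul_assoc, H.SS_rev, one_mul]
  rw [h3, ← h2] at h1
  simpa using h1

end CH

namespace CH
variable [Fintype I] [DecidableEq I] {c : I → I → ℤ} {d : I → ℤ} {r : ℤ}

theorem sum_erase_s (H : CH c d r) {M : Type*} [AddCommMonoid M] (F : (I → ℤ) → M) (i : I) :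
    ∑ v ∈ H.PhiP.erase (alphaZ i), F (sL c i v) = ∑ v ∈ H.PhiP.erase (alphaZ i), F v := by
  have hm : ∀ v ∈ H.PhiP.erase (alphaZ i), sL c i v ∈ H.PhiP.erase (alphaZ i) := by
    intro v hv
    rw [Finset.mem_erase, mem_PhiP] at hv ⊢
    refine ⟨fun h => ?_, rt_s hv.2.1 i, H.s_pos hv.2.1 hv.2.2 i hv.1⟩
    have : v = -alphaZ i := by rw [← H.s_invol i v, h, H.s_alpha]
    have h3 := hv.2.2 i
    simp [this, alphaZ] at h3
  exact Finset.sum_bij' (fun v _ => sL c i v) (fun v _ => sL c i v) hm hm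
    (fun v _ => H.s_invol i v) (fun v _ => H.s_invol i v) (fun v _ => rfl)

theorem alpha_mem (H : CH c d r) (i : I) : alphaZ i ∈ H.PhiP :=
  (H.mem_PhiP _).2 ⟨rt_alpha i, alpha_nonneg i⟩

theorem sum_s (H : CH c d r) {M : Type*} [AddCommMonoid M] (F : (I → ℤ) → M)
    (hF : ∀ v, F (-v) = F v) (i : I) :
    ∑ v ∈ H.PhiP, F (sL c i v) = ∑ v ∈ H.PhiP, F v := by
  rw [← Finset.add_sum_erase _ _ (H.alpha_mem i), ← Finset.add_sum_erase _ F (H.alpha_mem i),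
    H.sum_erase_s, H.s_alpha, hF]

theorem rt_norm (H : CH c d r) {v : I → ℤ} (h : IsRt c v) :
    ∃ i, Bz c d v v = 2 * d i ∧ ∀ k, d i ∣ d k * v k := by
  obtain ⟨l, i, rfl⟩ := h
  exact ⟨i, by rw [H.B_S, H.Baa], H.rt_div l i⟩

/-- a root maximal in height among roots of its length is dominant; the highest root is dominant and long -/
theorem theta_dom (H : CH c d r) {θ : I → ℤ} (hθ : IsRt c θ) (hh : ∀ β, IsRt c β → β ≤ θ) (i : I) :
    0 ≤ co c i θ := by
  have := hh _ (rt_s hθ i) i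
  simp only [sL_apply, Pi.sub_apply, Pi.smul_apply, alphaZ, Pi.single_eq_same, smul_eq_mul] at this
  linarith

theorem theta_long (H : CH c d r) {θ : I → ℤ} (hθ : IsRt c θ) (hh : ∀ β, IsRt c β → β ≤ θ) :
    Bz c d θ θ = 2 * r := by
  classical
  obtain ⟨j, hj⟩ := H.rmem
  obtain ⟨β, hβ, hmax⟩ := Finset.exists_max_image
    (H.rt_fin.toFinset.filter (fun v => Bz c d v v = 2 * r)) (fun v => ∑ k, v k)
    ⟨alphaZ j, by simp [rt_alpha, H.Baa, hj]⟩
  simp only [Finset.mem_filter, Set.Finite.mem_toFinset, Set.mem_ofPred_eq] at hβ hmax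
  have hdom : ∀ i, 0 ≤ co c i β := by
    intro i
    have := hmax (sL c i β) ⟨rt_s hβ.1 i, by rw [H.B_s]; exact hβ.2⟩
    simp only [sL_apply, Pi.sub_apply, Pi.smul_apply, smul_eq_mul, Finset.sum_sub_distrib, ← Finset.mul_sum] at this
    simp [alphaZ] at this
    linarith
  have h1 : 0 ≤ Bz c d (θ - β) (θ + β) := by
    rw [Bz_expand]
    refine Finset.sum_nonneg fun i _ => ?_
    have := hh β hβ.1 i
    refine mul_nonneg (by simpa using this) (mul_nonneg (H.dpos i).le ?_)
    rw [map_add]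
    exact add_nonneg (H.theta_dom hθ hh i) (hdom i)
  simp only [map_sub, map_add, LinearMap.sub_apply] at h1
  have h2 := H.Bsymm θ β
  obtain ⟨i, hi, _⟩ := H.rt_norm hθ
  have := H.rmax i
  linarith

theorem trace_id (H : CH c d r) {θ : I → ℤ} (hθ : IsRt c θ) (hh : ∀ β, IsRt c β → β ≤ θ)
    (φ : ℤ → ℤ) :
    (Fintype.card I : ℤ) * (∑ i, θ i * (d i * φ (2 * d i)) + r * φ (2 * r))
      = ∑ v ∈ H.PhiP, φ (Bz c d v v) * Bz c d v v := by
  classical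
  have hr := H.rpos
  have hθB := H.theta_long hθ hh
  have hθ0 : 0 ≤ θ := by
    rcases H.rt_dich hθ with h | h
    · exact h
    · exact (H.rt_not_both (rt_alpha H.rmem.choose) (alpha_nonneg _) ((hh _ (rt_alpha _)).trans h)).elim
  let M : (I → ℤ) →ₗ[ℤ] (I → ℤ) := ∑ v ∈ H.PhiP, (φ (Bz c d v v) • Bz c d v).smulRight v
  have hM : ∀ x, M x = ∑ v ∈ H.PhiP, (φ (Bz c d v v) * Bz c d v x) • v := by
    intro x; simp [M, LinearMap.sum_apply]
  have hcomm : ∀ i x, M (sL c i x) = sL c i (M x) := by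
    intro i x
    rw [hM, hM, map_sum, ← H.sum_s _ _ i]
    · refine Finset.sum_congr rfl fun v _ => ?_
      rw [H.B_s, H.B_s, map_smul]
    · intro v; simp
  have hMi : ∀ i, M (alphaZ i) = (M (alphaZ i) i) • alphaZ i := by
    intro i
    have h := hcomm i (alphaZ i)
    rw [H.s_alpha, map_neg] at h
    funext k
    by_cases hk : k = i
    · subst hk; simp [alphaZ]
    · have h2 := congrFun h k
      rw [sL_apply_ne c i k hk, Pi.neg_apply] at h2
      have h3 : M (alphaZ i) k = 0 := by omega
      rw [h3]; simp [alphaZ, Pi.single_apply, hk]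
  obtain ⟨i0, hi0⟩ := H.rmem
  let κ := M (alphaZ i0) i0
  have hκ : ∀ i, M (alphaZ i) i = κ := by
    intro i
    refine H.const_of_adj (fun i => M (alphaZ i) i) ?_ i i0
    intro i j hij hc
    have h := hcomm i (alphaZ j)
    simp only [sL_apply, map_sub, map_smul, co_alpha] at h
    rw [hMi i, hMi j] at h
    simp only [map_smul, co_alpha] at h
    have h2 := congrFun h i
    simp [alphaZ, Pi.single_apply, hij] at h2
    have : c i j * (M (alphaZ i) i) = c i j * (M (alphaZ j) j) := by
      simp only [alphaZ]; linarith
    exact mul_left_cancel₀ hc this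
  have hMx : ∀ x, M x = κ • x := by
    intro x
    conv_lhs => rw [vec_sum x]
    rw [map_sum]
    conv_rhs => rw [vec_sum x]
    rw [Finset.smul_sum]
    refine Finset.sum_congr rfl fun i _ => ?_
    rw [map_smul, hMi, hκ, smul_comm]
  -- trace
  have htr : (Fintype.card I : ℤ) * κ = ∑ v ∈ H.PhiP, φ (Bz c d v v) * Bz c d v v := by
    have : ∑ i : I, M (alphaZ i) i = ∑ i : I, κ := Finset.sum_congr rfl fun i _ => hκ i
    rw [Finset.sum_const, Finset.card_univ, nsmul_eq_mul] at this
    rw [← this]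
    simp only [hM, Finset.sum_apply, Pi.smul_apply, smul_eq_mul]
    rw [Finset.sum_comm]
    refine Finset.sum_congr rfl fun v _ => ?_
    generalize φ (Bz c d v v) = x
    rw [Bz_expand, Finset.mul_sum]
    refine Finset.sum_congr rfl fun i _ => ?_
    rw [H.Bz_alpha_right]; ring
  -- the weighted rho
  let ρ : I → ℤ := ∑ v ∈ H.PhiP, φ (Bz c d v v) • v
  have hρ : ∀ i, co c i ρ = 2 * φ (2 * d i) := by
    intro i
    have e : ρ = φ (2 * d i) • alphaZ i + ∑ v ∈ H.PhiP.erase (alphaZ i), φ (Bz c d v v) • v := by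
      simp only [ρ]
      rw [← Finset.add_sum_erase _ _ (H.alpha_mem i), H.Baa]
    have e2 : sL c i ρ = -φ (2 * d i) • alphaZ i
        + ∑ v ∈ H.PhiP.erase (alphaZ i), φ (Bz c d v v) • v := by
      rw [e, map_add, map_smul, H.s_alpha, map_sum, ← H.sum_erase_s (fun v => φ (Bz c d v v) • v) i]
      simp only [map_smul, H.B_s, smul_neg, neg_smul]
    rw [sL_apply] at e2
    have e4 := congrFun e2 i
    have e5 := congrFun e i
    simp only [Pi.sub_apply, Pi.add_apply, Pi.smul_apply, smul_eq_mul, alphaZ, Pi.single_eq_same] at e4 e5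
    linarith
  have hρθ : Bz c d θ ρ = 2 * ∑ i, θ i * (d i * φ (2 * d i)) := by
    rw [Bz_expand, Finset.mul_sum]
    refine Finset.sum_congr rfl fun i _ => ?_
    rw [hρ]; ring
  have hρθ' : Bz c d θ ρ = ∑ v ∈ H.PhiP, φ (Bz c d v v) * Bz c d θ v := by
    simp only [ρ, map_sum, map_smul, smul_eq_mul]
  have hMθ : Bz c d θ (M θ) = κ * (2 * r) := by rw [hMx, map_smul, hθB, smul_eq_mul]
  have hMθ' : Bz c d θ (M θ) = ∑ v ∈ H.PhiP, φ (Bz c d v v) * (Bz c d θ v * Bz c d θ v) := by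
    rw [hM, map_sum]
    refine Finset.sum_congr rfl fun v _ => ?_
    rw [map_smul, smul_eq_mul, H.Bsymm v θ]; ring
  have hθm : θ ∈ H.PhiP := (H.mem_PhiP _).2 ⟨hθ, hθ0⟩
  have hdiv : ∀ v, r ∣ Bz c d θ v := by
    intro v
    obtain ⟨i, h1, h2⟩ := H.rt_norm hθ
    have : d i = r := by linarith
    rw [Bz_expand]
    refine Finset.dvd_sum fun k _ => ?_
    have h3 := (h2 k).mul_right (co c k v)
    rw [this] at h3
    convert h3 using 1; ring
  have hsq : ∀ v ∈ H.PhiP.erase θ, Bz c d θ v * Bz c d θ v = r * Bz c d θ v := by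
    intro v hv
    rw [Finset.mem_erase, mem_PhiP] at hv
    obtain ⟨m, hm⟩ := hdiv v
    have h0 : 0 ≤ Bz c d θ v := by
      rw [H.Bsymm, Bz_expand]
      exact Finset.sum_nonneg fun i _ => mul_nonneg (hv.2.2 i)
        (mul_nonneg (H.dpos i).le (H.theta_dom hθ hh i))
    have h1 := H.posdef (θ - v) (sub_ne_zero.2 (Ne.symm hv.1))
    simp only [map_sub, LinearMap.sub_apply] at h1
    obtain ⟨i, h2, _⟩ := H.rt_norm hv.2.1
    have h3 := H.rmax i
    have h4 := H.Bsymm v θ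
    rw [hm] at h0
    have hm0 : 0 ≤ m := by
      by_contra hneg
      push Not at hneg
      nlinarith
    have hm2 : m < 2 := by
      by_contra hneg
      push Not at hneg
      nlinarith
    rw [hm]
    interval_cases m <;> ring
  have hfin : κ * (2 * r) = r * (2 * ∑ i, θ i * (d i * φ (2 * d i))) + 2 * r * (r * φ (2 * r)) := by
    rw [← hMθ, hMθ', ← hρθ, hρθ', ← Finset.add_sum_erase _ _ hθm, ← Finset.add_sum_erase _ (fun v => φ (Bz c d v v) * Bz c d θ v) hθm, hθB, mul_add, Finset.mul_sum]
    have : ∑ v ∈ H.PhiP.erase θ, φ (Bz c d v v) * (Bz c d θ v * Bz c d θ v)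
        = ∑ v ∈ H.PhiP.erase θ, r * (φ (Bz c d v v) * Bz c d θ v) := by
      refine Finset.sum_congr rfl fun v hv => ?_
      rw [hsq v hv]; ring
    rw [this]; ring
  have : κ = ∑ i, θ i * (d i * φ (2 * d i)) + r * φ (2 * r) := by
    have h2 : (2 * r) ≠ 0 := by omega
    refine mul_right_cancel₀ h2 ?_
    rw [hfin]; ring
  rw [← htr, this]

theorem trace_N (H : CH c d r) {θ : I → ℤ} (hθ : IsRt c θ) (hh : ∀ β, IsRt c β → β ≤ θ) :
    (Fintype.card I : ℤ) * (r + ∑ i, θ i * d i) = ∑ v ∈ H.PhiP, Bz c d v v := by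
  have := H.trace_id hθ hh (fun _ => 1)
  simp only [mul_one, one_mul] at this
  rw [← this]; ring

theorem trace_h (H : CH c d r) {θ : I → ℤ} (hθ : IsRt c θ) (hh : ∀ β, IsRt c β → β ≤ θ) :
    (Fintype.card I : ℤ) * (1 + ∑ i, θ i) = 2 * ∑ v ∈ H.PhiP, 1 := by
  have := H.trace_id hθ hh (fun x => 2 * r / x)
  have hr := H.rpos
  have hd : ∀ i, d i * (2 * r / (2 * d i)) = r := by
    intro i
    rw [Int.mul_ediv_mul_of_pos _ _ (by norm_num)]
    rcases H.oner i with h | h <;> rw [h]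
    · simp
    · rw [Int.ediv_self hr.ne', mul_one]
  have h1 : ∑ v ∈ H.PhiP, 2 * r / (Bz c d v v) * Bz c d v v = ∑ v ∈ H.PhiP, 2 * r := by
    refine Finset.sum_congr rfl fun v hv => ?_
    obtain ⟨i, hi, _⟩ := H.rt_norm ((H.mem_PhiP v).1 hv).1
    rw [hi]; linear_combination 2 * hd i
  simp only [hd] at this
  rw [h1, Int.ediv_self (by omega), ← Finset.sum_mul] at this
  rw [Finset.sum_const, nsmul_eq_mul] at this
  rw [Finset.sum_const, nsmul_eq_mul]
  refine mul_right_cancel₀ hr.ne' ?_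
  linear_combination this

end CH

/-- evaluation at q = t = 1 -/
def ev1 : MvPolynomial (Fin 2) ℚ →+* ℚ := MvPolynomial.eval (fun _ => 1)

/-- `z` specialises to `a` at q = t = 1 -/
def Spz (z : KK) (a : ℚ) : Prop :=
  ∃ p s : MvPolynomial (Fin 2) ℚ, ev1 s ≠ 0 ∧ z * algebraMap _ KK s = algebraMap _ KK p ∧
    ev1 p = a * ev1 s

namespace Spz

theorem amap_inj : Function.Injective (algebraMap (MvPolynomial (Fin 2) ℚ) KK) :=
  IsFractionRing.injective _ _

theorem unique {z : KK} {a b : ℚ} (h1 : Spz z a) (h2 : Spz z b) : a = b := by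
  obtain ⟨p, s, hs, h, e⟩ := h1
  obtain ⟨p', s', hs', h', e'⟩ := h2
  have : algebraMap (MvPolynomial (Fin 2) ℚ) KK (p * s') = algebraMap _ KK (p' * s) := by
    rw [map_mul, map_mul, ← h, ← h']; ring
  have := congrArg ev1 (amap_inj this)
  rw [map_mul, map_mul, e, e'] at this
  have h3 : a * (ev1 s * ev1 s') = b * (ev1 s * ev1 s') := by linarith
  exact mul_right_cancel₀ (mul_ne_zero hs hs') h3

theorem add {z z' : KK} {a b : ℚ} (h1 : Spz z a) (h2 : Spz z' b) : Spz (z + z') (a + b) := by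
  obtain ⟨p, s, hs, h, e⟩ := h1
  obtain ⟨p', s', hs', h', e'⟩ := h2
  refine ⟨p * s' + p' * s, s * s', ?_, ?_, ?_⟩
  · rw [map_mul]; exact mul_ne_zero hs hs'
  · simp only [map_add, map_mul, ← h, ← h']; ring
  · simp only [map_add, map_mul, e, e']; ring

theorem mul {z z' : KK} {a b : ℚ} (h1 : Spz z a) (h2 : Spz z' b) : Spz (z * z') (a * b) := by
  obtain ⟨p, s, hs, h, e⟩ := h1
  obtain ⟨p', s', hs', h', e'⟩ := h2
  refine ⟨p * p', s * s', ?_, ?_, ?_⟩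
  · rw [map_mul]; exact mul_ne_zero hs hs'
  · simp only [map_mul, ← h, ← h']; ring
  · simp only [map_mul, e, e']; ring

theorem neg {z : KK} {a : ℚ} (h1 : Spz z a) : Spz (-z) (-a) := by
  obtain ⟨p, s, hs, h, e⟩ := h1
  exact ⟨-p, s, hs, by rw [map_neg, ← h]; ring, by rw [map_neg, e]; ring⟩

theorem sub {z z' : KK} {a b : ℚ} (h1 : Spz z a) (h2 : Spz z' b) : Spz (z - z') (a - b) := by
  rw [sub_eq_add_neg, sub_eq_add_neg]; exact h1.add h2.neg

theorem inv {z : KK} (h1 : Spz z 1) : Spz z⁻¹ 1 := by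
  have hz : z ≠ 0 := by
    rintro rfl
    have h0 : Spz 0 0 := ⟨0, 1, by simp, by simp, by simp⟩
    exact zero_ne_one (h0.unique h1)
  obtain ⟨p, s, hs, h, e⟩ := h1
  refine ⟨s, p, by rw [e]; simpa using hs, ?_, by rw [e]; ring⟩
  rw [← h, ← mul_assoc, inv_mul_cancel₀ hz, one_mul]

theorem zero : Spz 0 0 := ⟨0, 1, by simp, by simp, by simp⟩
theorem one : Spz 1 1 := ⟨1, 1, by simp, by simp, by simp⟩

theorem ne_zero {z : KK} {a : ℚ} (h : Spz z a) (ha : a ≠ 0) : z ≠ 0 := by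
  rintro rfl
  exact ha (h.unique zero)

theorem pow {z : KK} (h : Spz z 1) (n : ℕ) : Spz (z ^ n) 1 := by
  induction n with
  | zero => simpa using one
  | succ n ih => rw [pow_succ]; simpa using ih.mul h

theorem zpow {z : KK} (h : Spz z 1) (n : ℤ) : Spz (z ^ n) 1 := by
  cases n with
  | ofNat n => simpa using h.pow n
  | negSucc n => rw [zpow_negSucc]; exact (h.pow _).inv

theorem q : Spz qv 1 := ⟨MvPolynomial.X 0, 1, by simp, by simp [qv], by simp [ev1]⟩
theorem t : Spz tv 1 := ⟨MvPolynomial.X 1, 1, by simp, by simp [tv], by simp [ev1]⟩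

theorem sum {α : Type*} (s : Finset α) (f : α → KK) (g : α → ℚ) (h : ∀ a ∈ s, Spz (f a) (g a)) :
    Spz (∑ a ∈ s, f a) (∑ a ∈ s, g a) := by
  classical
  induction s using Finset.induction_on with
  | empty => simpa using zero
  | insert a s ha ih =>
    rw [Finset.sum_insert ha, Finset.sum_insert ha]
    exact (h a (Finset.mem_insert_self _ _)).add (ih fun b hb => h b (Finset.mem_insert_of_mem hb))

end Spz

theorem qv_ne : qv ≠ 0 := Spz.q.ne_zero one_ne_zero
theorem tv_ne : tv ≠ 0 := Spz.t.ne_zero one_ne_zero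

theorem qq_ne : qv - qv⁻¹ ≠ 0 := by
  intro h
  have h2 : qv * qv = 1 := by
    have := congrArg (· * qv) h
    simp only [sub_mul, inv_mul_cancel₀ qv_ne, zero_mul] at this
    exact sub_eq_zero.1 this
  have h3 : (MvPolynomial.X 0 * MvPolynomial.X 0 : MvPolynomial (Fin 2) ℚ) = 1 := by
    apply Spz.amap_inj
    simpa [qv] using h2
  have := congrArg (MvPolynomial.eval (fun _ => (2 : ℚ))) h3
  norm_num at this

theorem qint_neg (k : ℤ) : qint (-k) = - qint k := by
  simp only [qint, neg_neg]; ring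

theorem qint_zero : qint 0 = 0 := by simp [qint]

theorem qint_succ (k : ℤ) : qint (k + 1) = qv * qint k + qv ^ (-k) := by
  have h := qq_ne
  have h0 := qv_ne
  simp only [qint]
  rw [eq_comm, ← mul_div_assoc, div_add' _ _ _ h, div_left_inj' h]
  rw [neg_add, zpow_add₀ h0, zpow_add₀ h0, zpow_one, zpow_neg_one]
  ring

theorem qint_one : qint 1 = 1 := by
  have := qint_succ 0
  simpa [qint_zero] using this

theorem Spz.qint (k : ℤ) : Spz (qint k) k := by
  have hn : ∀ n : ℕ, Spz (_root_.qint n) n := by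
    intro n
    induction n with
    | zero => simpa [qint_zero] using Spz.zero
    | succ n ih =>
      push_cast
      rw [qint_succ]
      simpa using (Spz.q.mul ih).add (Spz.q.zpow (-n))
  rcases Int.eq_nat_or_neg k with ⟨n, rfl | rfl⟩
  · exact_mod_cast hn n
  · rw [qint_neg]; push_cast; exact (hn n).neg

theorem qint_ne {k : ℤ} (hk : k ≠ 0) : qint k ≠ 0 := (Spz.qint k).ne_zero (by exact_mod_cast hk)

theorem root_unity {z : KK} {n : ℕ} (hn : n ≠ 0) (h : z ^ (2 * n) = 1) : z = 1 ∨ z = -1 := by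
  have hint : IsIntegral (MvPolynomial (Fin 2) ℚ) z := by
    refine ⟨Polynomial.X ^ (2 * n) - 1, Polynomial.monic_X_pow_sub_C 1 (by omega), ?_⟩
    simp [h]
  obtain ⟨p, rfl⟩ := IsIntegrallyClosed.isIntegral_iff.1 hint
  have hp : p ^ (2 * n) = 1 := by
    apply Spz.amap_inj; simpa using h
  have hu : IsUnit p := IsUnit.of_pow_eq_one hp (by omega)
  obtain ⟨a, ha, rfl⟩ := MvPolynomial.isUnit_iff_eq_C_of_isReduced.1 hu
  rw [← map_pow, ← MvPolynomial.C_1] at hp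
  have ha2 : a ^ (2 * n) = 1 := MvPolynomial.C_injective _ _ hp
  rcases (pow_eq_one_iff_cases.1 ha2) with h | h | h
  · omega
  · left; simp [h]
  · right; simp [h.1]

section braid
variable {R M : Type*} [CommRing R] [AddCommGroup M] [Module R M]
  {f g : M →ₗ[R] R} {α β : M} {A B : Module.End R M} {u v a b : R}

theorem br_step (hA : ∀ x, A x = x - f x • α) (hfa : f α = 1 + u) (hfb : f β = -a)
    (x : M) (P Q : R) :
    A (x - P • α - Q • β) = x - (f x - u * P + a * Q) • α - Q • β := by
  rw [hA]
  simp only [map_sub, map_smul, hfa, hfb, smul_eq_mul]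
  module

theorem br_step' (hB : ∀ x, B x = x - g x • β) (hga : g α = -b) (hgb : g β = 1 + v)
    (x : M) (P Q : R) :
    B (x - P • α - Q • β) = x - P • α - (g x - v * Q + b * P) • β := by
  rw [hB]
  simp only [map_sub, map_smul, hga, hgb, smul_eq_mul]
  module

theorem br_fin {x : M} {P Q P' Q' : R} (h1 : P = P') (h2 : Q = Q') :
    x - P • α - Q • β = x - P' • α - Q' • β := by rw [h1, h2]

theorem br2 (hA : ∀ x, A x = x - f x • α) (hB : ∀ x, B x = x - g x • β)
    (hfa : f α = 1 + u) (hfb : f β = -a) (hga : g α = -b) (hgb : g β = 1 + v)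
    (ha : a = 0) (hb : b = 0) (x : M) : A (B x) = B (A x) := by
  have sA := br_step hA hfa hfb x
  have sB := br_step' hB hga hgb x
  have e : x = x - (0 : R) • α - (0 : R) • β := by simp
  conv_lhs => rw [e, sB, sA]
  conv_rhs => rw [e, sA, sB]
  refine br_fin ?_ ?_
  · rw [ha]; ring
  · rw [hb]; ring

theorem br3 (hA : ∀ x, A x = x - f x • α) (hB : ∀ x, B x = x - g x • β)
    (hfa : f α = 1 + u) (hfb : f β = -a) (hga : g α = -b) (hgb : g β = 1 + v)
    (h1 : a * b = u) (h2 : a * b = v) (x : M) : A (B (A x)) = B (A (B x)) := by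
  have sA := br_step hA hfa hfb x
  have sB := br_step' hB hga hgb x
  have e : x = x - (0 : R) • α - (0 : R) • β := by simp
  conv_lhs => rw [e, sA, sB, sA]
  conv_rhs => rw [e, sB, sA, sB]
  refine br_fin ?_ ?_
  · linear_combination f x * h1
  · linear_combination -g x * h2

theorem br4 (hA : ∀ x, A x = x - f x • α) (hB : ∀ x, B x = x - g x • β)
    (hfa : f α = 1 + u) (hfb : f β = -a) (hga : g α = -b) (hgb : g β = 1 + v)
    (h1 : a * b = u + v) (x : M) : A (B (A (B x))) = B (A (B (A x))) := by
  have sA := br_step hA hfa hfb x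
  have sB := br_step' hB hga hgb x
  have e : x = x - (0 : R) • α - (0 : R) • β := by simp
  conv_lhs => rw [e, sB, sA, sB, sA]
  conv_rhs => rw [e, sA, sB, sA, sB]
  refine br_fin ?_ ?_
  · linear_combination a * g x * h1
  · linear_combination -b * f x * h1

theorem br6 (hA : ∀ x, A x = x - f x • α) (hB : ∀ x, B x = x - g x • β)
    (hfa : f α = 1 + u) (hfb : f β = -a) (hga : g α = -b) (hgb : g β = 1 + v) {w : R}
    (h1 : a * b = u + v + w) (h2 : w ^ 2 = u * v) (x : M) :
    A (B (A (B (A (B x))))) = B (A (B (A (B (A x))))) := by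
  have sA := br_step hA hfa hfb x
  have sB := br_step' hB hga hgb x
  have e : x = x - (0 : R) • α - (0 : R) • β := by simp
  conv_lhs => rw [e, sB, sA, sB, sA, sB, sA]
  conv_rhs => rw [e, sA, sB, sA, sB, sA, sB]
  refine br_fin ?_ ?_
  · linear_combination a * g x * (a * b - u - v + w) * h1 + a * g x * h2
  · linear_combination -b * f x * (a * b - u - v + w) * h1 - b * f x * h2

end braid

section Tops
variable [Fintype I] [DecidableEq I] (c : I → I → ℤ) (d : I → ℤ)

/-- the functional defining `T_i` -/
def ph (i : I) : (I → KK) →ₗ[KK] KK where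
  toFun v := qv ^ (-(d i)) * tv * ∑ j, Cqt c d i j * v j
  map_add' u v := by simp [mul_add, Finset.sum_add_distrib]
  map_smul' a v := by
    simp only [Pi.smul_apply, smul_eq_mul, Finset.mul_sum, RingHom.id_apply]
    exact Finset.sum_congr rfl fun _ _ => by ring

theorem ph_apply (i : I) (v : I → KK) :
    ph c d i v = qv ^ (-(d i)) * tv * ∑ j, Cqt c d i j * v j := rfl

theorem ph_alpha (i j : I) : ph c d i (alphaK j) = qv ^ (-(d i)) * tv * Cqt c d i j := by
  simp [ph_apply, alphaK, Pi.single_apply]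

theorem ph_self (i : I) : ph c d i (alphaK i) = 1 + (qv ^ (-(d i)) * tv) ^ 2 := by
  rw [ph_alpha, Cqt, if_pos rfl]
  have h1 : qv ^ (-(d i)) * qv ^ (d i) = 1 := by
    rw [zpow_neg, inv_mul_cancel₀ (zpow_ne_zero _ qv_ne)]
  have h2 : tv * tv⁻¹ = 1 := mul_inv_cancel₀ tv_ne
  linear_combination (tv * tv⁻¹) * h1 + h2

theorem ph_ne (i j : I) (h : i ≠ j) :
    ph c d i (alphaK j) = - (qv ^ (-(d i)) * tv * qint (-c i j)) := by
  rw [ph_alpha, Cqt, if_neg h, qint_neg]; ring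

/-- `T_i`, as a linear map -/
def tL (i : I) : Module.End KK (I → KK) where
  toFun v := v - ph c d i v • alphaK i
  map_add' u v := by simp only [map_add, add_smul]; abel
  map_smul' a v := by simp only [map_smul, smul_sub, smul_assoc, RingHom.id_apply]

theorem tL_apply (i : I) (v : I → KK) : tL c d i v = v - ph c d i v • alphaK i := rfl

theorem tL_Trefl (hd : ∀ i, 0 < d i) (i : I) (v : I → KK) : Trefl c d i v = tL c d i v := by
  funext k
  have hq := qint_ne (hd i).ne'
  have : Bform c d (alphaK i) v = qint (d i) * ∑ j, Cqt c d i j * v j := by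
    simp only [Bform, alphaK, Pi.single_apply]
    rw [Finset.sum_eq_single i (fun b _ hb => by simp [hb]) (by simp), Finset.mul_sum]
    exact Finset.sum_congr rfl fun _ _ => by simp; ring
  rw [Trefl, this, tL_apply, ph_apply, Pi.sub_apply, Pi.smul_apply, smul_eq_mul]
  field_simp

/-- word product of the `T_i` -/
def TT (l : List I) : Module.End KK (I → KK) := (l.map (tL c d)).prod

@[simp] theorem TT_nil : TT c d [] = 1 := rfl
@[simp] theorem TT_cons (i : I) (l : List I) : TT c d (i :: l) = tL c d i * TT c d l := by simp [TT]
@[simp] theorem TT_append (l m : List I) : TT c d (l ++ m) = TT c d l * TT c d m := by simp [TT]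

theorem TT_foldr (hd : ∀ i, 0 < d i) (l : List I) (v : I → KK) :
    l.foldr (fun a acc => Trefl c d a acc) v = TT c d l v := by
  induction l with
  | nil => rfl
  | cons a l ih => rw [List.foldr_cons, ih, tL_Trefl c d hd]; simp

/-- relative reducedness -/
def RR (g : Module.End ℤ (I → ℤ)) : List I → Prop
  | [] => True
  | x :: l => RR g l ∧ 0 ≤ g (SS c l.reverse (alphaZ x))

/-- rank two data for a pair -/
def BR (i j : I) : Prop := ∃ p q : List I,
  TT c d (i :: p) = TT c d (j :: q) ∧ SS c (i :: p) = SS c (j :: q) ∧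
  (SS c (i :: p) (alphaZ i) = -alphaZ i ∨ SS c (i :: p) (alphaZ i) = -alphaZ j) ∧
  (SS c (i :: p) (alphaZ j) = -alphaZ i ∨ SS c (i :: p) (alphaZ j) = -alphaZ j) ∧
  ∀ g : Module.End ℤ (I → ℤ), 0 ≤ g (alphaZ i) → 0 ≤ g (alphaZ j) →
    RR c g (i :: p) ∧ RR c g (j :: q)

theorem BR.symm {c : I → I → ℤ} {d : I → ℤ} {i j : I} (h : BR c d i j) : BR c d j i := by
  obtain ⟨p, q, h1, h2, h3, h4, h5⟩ := h
  refine ⟨q, p, h1.symm, h2.symm, ?_, ?_, fun g hi hj => (h5 g hj hi).symm⟩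
  · rw [← h2]; exact h4.symm
  · rw [← h2]; exact h3.symm

end Tops

theorem qint_two : qint 2 = qv + qv⁻¹ := by
  have := qint_succ 1
  simpa [qint_one] using this

theorem qint_three : qint 3 = qv ^ 2 + 1 + qv⁻¹ ^ 2 := by
  have := qint_succ 2
  rw [qint_two] at this
  norm_num at this
  rw [this, mul_add, mul_inv_cancel₀ qv_ne, inv_pow]; ring

namespace CH
variable [Fintype I] [DecidableEq I] {c : I → I → ℤ} {d : I → ℤ} {r : ℤ}

theorem BR_zero (H : CH c d r) {i j : I} (hij : i ≠ j) (h1 : c i j = 0) (h2 : c j i = 0) :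
    BR c d i j := by
  have ei := H.s_alpha i
  have ej := H.s_alpha j
  have eij : sL c i (alphaZ j) = alphaZ j := by rw [sL_apply, co_alpha, h1]; simp
  have eji : sL c j (alphaZ i) = alphaZ i := by rw [sL_apply, co_alpha, h2]; simp
  refine ⟨[j], [i], ?_, ?_, ?_, ?_, ?_⟩
  · refine LinearMap.ext fun x => ?_
    simpa using br2 (tL_apply c d i) (tL_apply c d j) (ph_self c d i) (ph_ne c d i j hij)
      (ph_ne c d j i hij.symm) (ph_self c d j) (by simp [h1, qint_zero]) (by simp [h2, qint_zero]) x
  · refine LinearMap.ext fun x => ?_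
    simpa using br2 (u := 1) (v := 1) (a := 0) (b := 0) (sL_apply c i) (sL_apply c j) (by rw [co_alpha, H.diag]; rfl)
      (by rw [co_alpha, h1]; simp) (by rw [co_alpha, h2]; simp) (by rw [co_alpha, H.diag]; rfl) rfl rfl x
  · simp [ei, eji]
  · simp [ej, eij]
  · intro g hi hj
    simp [RR, hi, hj, eij, eji]

theorem BR_one (H : CH c d r) {i j : I} (hij : i ≠ j) (h1 : c i j = -1) (h2 : c j i = -1)
    (hd : d i = d j) : BR c d i j := by
  have ei := H.s_alpha i
  have ej := H.s_alpha j
  have eij : sL c i (alphaZ j) = alphaZ j + alphaZ i := by rw [sL_apply, co_alpha, h1]; module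
  have eji : sL c j (alphaZ i) = alphaZ i + alphaZ j := by rw [sL_apply, co_alpha, h2]; module
  refine ⟨[j, i], [i, j], ?_, ?_, ?_, ?_, ?_⟩
  · refine LinearMap.ext fun x => ?_
    simpa using br3 (tL_apply c d i) (tL_apply c d j) (ph_self c d i) (ph_ne c d i j hij)
      (ph_ne c d j i hij.symm) (ph_self c d j) (by simp [h1, h2, qint_one, hd]; ring)
      (by simp [h1, h2, qint_one, hd]; ring) x
  · refine LinearMap.ext fun x => ?_
    simpa using br3 (u := 1) (v := 1) (a := 1) (b := 1) (sL_apply c i) (sL_apply c j) (by rw [co_alpha, H.diag]; rfl)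
      (by rw [co_alpha, h1]) (by rw [co_alpha, h2]) (by rw [co_alpha, H.diag]; rfl) (by norm_num) (by norm_num) x
  · right
    simp only [SS_cons, SS_nil, Module.End.mul_apply, Module.End.one_apply, map_add, map_neg, ei, ej, eij, eji]
    abel
  · left
    simp only [SS_cons, SS_nil, Module.End.mul_apply, Module.End.one_apply, map_add, map_neg, ei, ej, eij, eji]
    abel
  · intro g hi hj
    refine ⟨⟨⟨⟨trivial, ?_⟩, ?_⟩, ?_⟩, ⟨⟨⟨trivial, ?_⟩, ?_⟩, ?_⟩⟩ <;>
    · intro k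
      have := hi k
      have := hj k
      simp [ei, ej, eij, eji] at *
      linarith

theorem BR_two (H : CH c d r) {i j : I} (hij : i ≠ j) (h1 : c i j = -2) (h2 : c j i = -1)
    (hdi : d i = 1) (hdj : d j = 2) : BR c d i j := by
  have ei := H.s_alpha i
  have ej := H.s_alpha j
  have eij : sL c i (alphaZ j) = alphaZ j + 2 • alphaZ i := by rw [sL_apply, co_alpha, h1]; module
  have eji : sL c j (alphaZ i) = alphaZ i + alphaZ j := by rw [sL_apply, co_alpha, h2]; module
  refine ⟨[j, i, j], [i, j, i], ?_, ?_, ?_, ?_, ?_⟩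
  · refine LinearMap.ext fun x => ?_
    simpa using br4 (tL_apply c d i) (tL_apply c d j) (ph_self c d i) (ph_ne c d i j hij)
      (ph_ne c d j i hij.symm) (ph_self c d j) (by
        have := qv_ne
        simp only [h1, h2, neg_neg, qint_one, qint_two, hdi, hdj]
        simp only [zpow_neg, zpow_one, zpow_ofNat]
        field_simp) x
  · refine LinearMap.ext fun x => ?_
    simpa using br4 (u := 1) (v := 1) (a := 2) (b := 1) (sL_apply c i) (sL_apply c j) (by rw [co_alpha, H.diag]; rfl)
      (by rw [co_alpha, h1]) (by rw [co_alpha, h2]) (by rw [co_alpha, H.diag]; rfl) (by norm_num) x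
  · left
    simp only [SS_cons, SS_nil, Module.End.mul_apply, Module.End.one_apply, map_add, map_neg, map_nsmul, ei, ej, eij, eji]
    module
  · right
    simp only [SS_cons, SS_nil, Module.End.mul_apply, Module.End.one_apply, map_add, map_neg, map_nsmul, ei, ej, eij, eji]
    module
  · intro g hi hj
    refine ⟨⟨⟨⟨⟨trivial, ?_⟩, ?_⟩, ?_⟩, ?_⟩, ⟨⟨⟨⟨trivial, ?_⟩, ?_⟩, ?_⟩, ?_⟩⟩ <;>
    · intro k
      have := hi k
      have := hj k
      simp only [List.reverse_cons, List.reverse_nil, List.nil_append, List.cons_append, SS_cons, SS_nil,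
        Module.End.mul_apply, Module.End.one_apply, map_add, map_neg, map_nsmul, ei, ej, eij, eji]
      simp only [Pi.add_apply, Pi.neg_apply, Pi.smul_apply, Pi.zero_apply] at *
      simp only [nsmul_eq_mul, Nat.cast_ofNat] at *
      linarith

theorem BR_three (H : CH c d r) {i j : I} (hij : i ≠ j) (h1 : c i j = -3) (h2 : c j i = -1)
    (hdi : d i = 1) (hdj : d j = 3) : BR c d i j := by
  have ei := H.s_alpha i
  have ej := H.s_alpha j
  have eij : sL c i (alphaZ j) = alphaZ j + 3 • alphaZ i := by rw [sL_apply, co_alpha, h1]; module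
  have eji : sL c j (alphaZ i) = alphaZ i + alphaZ j := by rw [sL_apply, co_alpha, h2]; module
  refine ⟨[j, i, j, i, j], [i, j, i, j, i], ?_, ?_, ?_, ?_, ?_⟩
  · refine LinearMap.ext fun x => ?_
    simpa using br6 (w := qv⁻¹ ^ 4 * tv ^ 2) (tL_apply c d i) (tL_apply c d j) (ph_self c d i) (ph_ne c d i j hij)
      (ph_ne c d j i hij.symm) (ph_self c d j) (by
        have := qv_ne
        simp only [h1, h2, neg_neg, qint_one, qint_three, hdi, hdj]
        simp only [zpow_neg, zpow_one, zpow_ofNat]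
        field_simp
        ring) (by
        have := qv_ne
        simp only [hdi, hdj]
        simp only [zpow_neg, zpow_one, zpow_ofNat]
        field_simp) x
  · refine LinearMap.ext fun x => ?_
    simpa using br6 (u := 1) (v := 1) (a := 3) (b := 1) (w := 1) (sL_apply c i) (sL_apply c j) (by rw [co_alpha, H.diag]; rfl)
      (by rw [co_alpha, h1]) (by rw [co_alpha, h2]) (by rw [co_alpha, H.diag]; rfl) (by norm_num) (by norm_num) x
  · left
    simp only [SS_cons, SS_nil, Module.End.mul_apply, Module.End.one_apply, map_add, map_neg, map_nsmul, ei, ej, eij, eji]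
    module
  · right
    simp only [SS_cons, SS_nil, Module.End.mul_apply, Module.End.one_apply, map_add, map_neg, map_nsmul, ei, ej, eij, eji]
    module
  · intro g hi hj
    refine ⟨⟨⟨⟨⟨⟨⟨trivial, ?_⟩, ?_⟩, ?_⟩, ?_⟩, ?_⟩, ?_⟩, ⟨⟨⟨⟨⟨⟨trivial, ?_⟩, ?_⟩, ?_⟩, ?_⟩, ?_⟩, ?_⟩⟩ <;>
    · intro k
      have := hi k
      have := hj k
      simp only [List.reverse_cons, List.reverse_nil, List.nil_append, List.cons_append, SS_cons, SS_nil,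
        Module.End.mul_apply, Module.End.one_apply, map_add, map_neg, map_nsmul, ei, ej, eij, eji]
      simp only [Pi.add_apply, Pi.neg_apply, Pi.smul_apply, Pi.zero_apply] at *
      simp only [nsmul_eq_mul, Nat.cast_ofNat] at *
      linarith

theorem BR_le (H : CH c d r) {i j : I} (hij : i ≠ j) (hle : d i ≤ d j) : BR c d i j := by
  have hs := H.symm i j
  have hi := H.dpos i
  have hj := H.dpos j
  by_cases h0 : c i j = 0
  · refine H.BR_zero hij h0 ?_
    rw [h0, mul_zero] at hs
    rcases mul_eq_zero.1 hs.symm with h | h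
    · omega
    · exact h
  have hb := H.bmax i j hij h0
  rw [max_eq_right hle] at hb
  have hji : c j i = -1 := by
    refine mul_left_cancel₀ hj.ne' ?_
    rw [← hs, hb]; ring
  rcases hle.eq_or_lt with he | hlt
  · refine H.BR_one hij ?_ hji he
    refine mul_left_cancel₀ hi.ne' ?_
    rw [hb, he]; ring
  · have hdi : d i = 1 := by
      rcases H.oner i with h | h
      · exact h
      · have := H.rmax j; omega
    rw [hdi, one_mul] at hb
    have hpos := H.posdef ((2 : ℤ) • alphaZ i + alphaZ j) (by
      intro h
      have := congrFun h j
      simp [alphaZ, Pi.single_apply, hij.symm] at this)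
    simp only [map_add, map_smul, LinearMap.add_apply, LinearMap.smul_apply, smul_eq_mul,
      Bz_alpha_left, co_alpha, H.diag, hb, hji, hdi] at hpos
    push_cast at hpos
    have h4 : d j < 4 := by linarith
    have h5 : d j = 2 ∨ d j = 3 := by omega
    rcases h5 with h5 | h5
    · exact H.BR_two hij (by rw [hb, h5]) hji hdi h5
    · exact H.BR_three hij (by rw [hb, h5]) hji hdi h5

theorem BR_all (H : CH c d r) {i j : I} (hij : i ≠ j) : BR c d i j := by
  rcases le_total (d i) (d j) with h | h
  · exact H.BR_le hij h
  · exact (H.BR_le hij.symm h).symm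

end CH

namespace CH
variable [Fintype I] [DecidableEq I] {c : I → I → ℤ} {d : I → ℤ} {r : ℤ}

theorem rev_eq (H : CH c d r) {l m : List I} (h : SS c l = SS c m) :
    SS c l.reverse = SS c m.reverse := by
  have h1 := H.SS_rev l
  have h2 := H.SS_rev' m
  calc SS c l.reverse = SS c l.reverse * (SS c m * SS c m.reverse) := by rw [h2, mul_one]
    _ = (SS c l.reverse * SS c l) * SS c m.reverse := by rw [h, mul_assoc]
    _ = SS c m.reverse := by rw [h1, one_mul]

theorem Red_append (u m : List I) (hu : Red c u) (hm : RR c (SS c u.reverse) m) :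
    Red c (m ++ u) := by
  induction m with
  | nil => simpa using hu
  | cons x m ih =>
    refine ⟨ih hm.1, ?_⟩
    have := hm.2
    rw [List.append_eq, List.reverse_append, SS_append]
    exact this

theorem cancel (H : CH c d r) {i : I} {a b : List I} (h : SS c (i :: a) = SS c (i :: b)) :
    SS c a = SS c b := by
  have h1 : sL c i * SS c (i :: a) = sL c i * SS c (i :: b) := by rw [h]
  simpa [← mul_assoc, H.s_mul_self] using h1

theorem head_neg (H : CH c d r) {i : I} {a : List I} (h : Red c (i :: a)) :
    SS c (i :: a).reverse (alphaZ i) ≤ 0 := by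
  have := h.2
  simp only [List.reverse_cons, SS_append, SS_cons, SS_nil, mul_one, Module.End.mul_apply,
    H.s_alpha, map_neg]
  simpa using this

theorem matsumoto (H : CH c d r) (n : ℕ) : ∀ l1 l2 : List I, l1.length = n → Red c l1 → Red c l2 →
    SS c l1 = SS c l2 → TT c d l1 = TT c d l2 := by
  induction n with
  | zero =>
    intro l1 l2 hn h1 h2 h
    have hl := H.red_length l1 l2 h1 h2 h
    rw [List.length_eq_zero_iff.1 hn, List.length_eq_zero_iff.1 (hl.symm.trans hn)]
  | succ n ih =>
    intro l1 l2 hn h1 h2 h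
    have hl := H.red_length l1 l2 h1 h2 h
    obtain ⟨i, a, rfl⟩ : ∃ i a, l1 = i :: a := List.exists_cons_of_length_eq_add_one hn
    obtain ⟨j, b, rfl⟩ : ∃ i a, l2 = i :: a := List.exists_cons_of_length_eq_add_one (hl.symm.trans hn)
    have hna : a.length = n := by simpa using hn
    have hnb : b.length = n := by simpa using (hl.symm.trans hn)
    by_cases hij : i = j
    · subst hij
      rw [TT_cons, TT_cons, ih a b hna h1.1 h2.1 (H.cancel h)]
    · obtain ⟨p, q, b1, b2, b3, b4, b5⟩ := H.BR_all hij
      obtain ⟨u, hu, hus⟩ := H.exists_red ((i :: p).reverse ++ (i :: a))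
      have ni := H.head_neg h1
      have nj := H.head_neg h2
      rw [← H.rev_eq h] at nj
      have hg : SS c u.reverse = SS c (i :: a).reverse * SS c (i :: p) := by
        rw [H.rev_eq hus, List.reverse_append, List.reverse_reverse, SS_append]
      have gi : 0 ≤ SS c u.reverse (alphaZ i) := by
        rw [hg, Module.End.mul_apply]
        rcases b3 with e | e <;> rw [e, map_neg]
        · exact neg_nonneg.2 ni
        · exact neg_nonneg.2 nj
      have gj : 0 ≤ SS c u.reverse (alphaZ j) := by
        rw [hg, Module.End.mul_apply]
        rcases b4 with e | e <;> rw [e, map_neg]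
        · exact neg_nonneg.2 ni
        · exact neg_nonneg.2 nj
      obtain ⟨r1, r2⟩ := b5 _ gi gj
      have R1 := Red_append u _ hu r1
      have R2 := Red_append u _ hu r2
      have S1 : SS c (i :: a) = SS c (i :: (p ++ u)) := by
        rw [← List.cons_append, SS_append, hus, SS_append, ← mul_assoc, H.SS_rev', one_mul]
      have S2 : SS c (j :: b) = SS c (j :: (q ++ u)) := by
        rw [← h, S1, ← List.cons_append, ← List.cons_append, SS_append, SS_append (l := j :: q), b2]
      have E1 := ih a _ hna h1.1 R1.1 (H.cancel S1)
      have E2 := ih b _ hnb h2.1 R2.1 (H.cancel S2)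
      rw [TT_cons, TT_cons (i := j), E1, E2]
      simp only [List.append_eq, TT_append, TT_cons] at b1 ⊢
      rw [← mul_assoc, ← mul_assoc, b1]

/-- minimal words are reduced -/
theorem red_of_min (H : CH c d r) (l : List I) (h : ∀ m, SS c m = SS c l → l.length ≤ m.length) :
    Red c l := by
  by_contra hn
  obtain ⟨m, h1, h2⟩ := H.shorter l hn
  have := h m h2
  omega

theorem SS_w0_conj (H : CH c d r) {ww : List I} {i k : I}
    (hs : SS c ww (alphaZ i) = - alphaZ k) :
    sL c k * SS c ww = SS c ww * sL c i := by
  have h1 : SS c (ww ++ [i]) (alphaZ i) = alphaZ k := by simp [H.s_alpha, hs]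
  have h2 := H.conj _ _ _ h1
  simp only [SS_append, SS_cons, SS_nil, mul_one, mul_assoc, H.s_mul_self] at h2
  calc sL c k * SS c ww = sL c k * (SS c ww * (sL c i * sL c i)) := by rw [H.s_mul_self, mul_one]
    _ = (sL c k * (SS c ww * sL c i)) * sL c i := by simp only [mul_assoc]
    _ = _ := by rw [h2]

theorem TT_w0_conj (H : CH c d r) {ww : List I} 
    (hmin : ∀ m, SS c m = SS c ww → ww.length ≤ m.length) {i k : I}
    (hs : SS c ww (alphaZ i) = - alphaZ k) :
    tL c d k * TT c d ww = TT c d ww * tL c d i := by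
  have hR := H.red_of_min ww hmin
  obtain ⟨u, hu, hus⟩ := H.exists_red (ww ++ [i])
  simp only [SS_append, SS_cons, SS_nil, mul_one] at hus
  have hc := H.SS_w0_conj hs
  have e1 : SS c (k :: u) = SS c ww := by
    rw [SS_cons, hus, ← hc, ← mul_assoc, H.s_mul_self, one_mul]
  have e2 : SS c (u ++ [i]) = SS c ww := by
    simp [hus, mul_assoc, H.s_mul_self]
  have r1 : Red c (k :: u) := by
    refine ⟨hu, ?_⟩
    have : SS c u.reverse (alphaZ k) = alphaZ i := by
      apply H.SS_inj u
      rw [H.SS_rev_apply', hus]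
      simp [H.s_alpha, hs]
    rw [this]
    exact alpha_nonneg i
  have hl := H.red_length _ _ r1 hR e1
  have r2 : Red c (u ++ [i]) := by
    refine H.red_of_min _ fun m hm => ?_
    have := hmin m (hm.trans e2)
    simp at hl ⊢
    omega
  have t1 := H.matsumoto _ _ _ rfl r1 hR e1
  have t2 := H.matsumoto _ _ _ rfl r2 hR e2
  simp only [TT_cons, TT_append, TT_nil, mul_one] at t1 t2
  conv_lhs => rw [← t2, ← mul_assoc, t1]

end CH

section sp
variable [Fintype I] [DecidableEq I] {c : I → I → ℤ} {d : I → ℤ} {r : ℤ}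

theorem Spz.Cqt (H : CH c d r) (i j : I) : Spz (Cqt c d i j) (c i j) := by
  unfold _root_.Cqt
  split_ifs with h
  · subst h
    have := ((Spz.q.zpow (d i)).mul Spz.t.inv).add ((Spz.q.zpow (-(d i))).mul Spz.t)
    rw [H.diag]
    norm_num at this ⊢
    exact this
  · exact Spz.qint _

theorem Spz.TTw (H : CH c d r) (l : List I) (i k : I) :
    Spz (TT c d l (alphaK i) k) (SS c l (alphaZ i) k : ℤ) := by
  induction l generalizing k with
  | nil =>
    simp only [TT_nil, SS_nil, Module.End.one_apply, alphaK, alphaZ, Pi.single_apply]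
    split_ifs
    · exact_mod_cast Spz.one
    · exact_mod_cast Spz.zero
  | cons a l ih =>
    simp only [TT_cons, SS_cons, Module.End.mul_apply, tL_apply, sL_apply, ph_apply, co_apply,
      Pi.sub_apply, Pi.smul_apply, smul_eq_mul]
    have hs := Spz.sum Finset.univ _ _ (fun j _ => (Spz.Cqt H a j).mul (ih j))
    have hα : Spz (alphaK a k) ((alphaZ a k : ℤ) : ℚ) := by
      simp only [alphaK, alphaZ, Pi.single_apply]
      split_ifs
      · exact_mod_cast Spz.one
      · exact_mod_cast Spz.zero
    have := (ih k).sub ((((Spz.q.zpow (-(d a))).mul Spz.t).mul hs).mul hα)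
    convert this using 1
    push_cast
    ring

theorem vecK_sum (v : I → KK) : v = ∑ i, v i • alphaK i := by
  funext k
  simp [alphaK, Pi.single_apply, Finset.sum_apply]

theorem det_tL (i : I) : LinearMap.det (tL c d i) = -(qv ^ (-(d i)) * tv) ^ 2 := by
  have h : LinearMap.toMatrix' (tL c d i) =
      1 + Matrix.replicateCol Unit (alphaK i) * Matrix.replicateRow Unit
        (fun j => - ph c d i (alphaK j)) := by
    ext a b
    rw [LinearMap.toMatrix'_apply, tL_apply]
    simp [Matrix.one_apply, Matrix.mul_apply, alphaK, Pi.single_apply]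
    ring
  rw [← LinearMap.det_toMatrix', h, Matrix.det_one_add_replicateCol_mul_replicateRow]
  have := ph_self c d i
  simp [alphaK, dotProduct, Pi.single_apply] at this ⊢
  rw [this]; ring

end sp

section fin
variable [Fintype I] [DecidableEq I] {c : I → I → ℤ} {d : I → ℤ} {r : ℤ}

theorem det_TT (H : CH c d r) (l : List I) : (LinearMap.det (TT c d l)) ^ 2 =
    (qv ^ (-(l.map fun i => Bz c d (alphaZ i) (alphaZ i)).sum) *
      tv ^ (2 * (l.map fun _ => (1 : ℤ)).sum)) ^ 2 := by
  induction l with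
  | nil => simp
  | cons a l ih =>
    rw [TT_cons, map_mul, mul_pow, ih, det_tL]
    simp only [List.map_cons, List.sum_cons, H.Baa]
    rw [neg_add, mul_add, zpow_add₀ qv_ne, zpow_add₀ tv_ne, mul_one]
    have h1 : qv ^ (-(2 * d a)) = (qv ^ (-(d a))) ^ 2 := by
      rw [← zpow_natCast, ← zpow_mul]; congr 1; push_cast; ring
    have h2 : tv ^ (2 : ℤ) = tv ^ 2 := by norm_cast
    rw [h1, h2]; ring

namespace CH

theorem e_ne (i : I) : 1 + (qv ^ (-(d i)) * tv) ^ 2 ≠ 0 := by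
  have := Spz.one.add ((((Spz.q.zpow (-(d i))).mul Spz.t)).mul ((Spz.q.zpow (-(d i))).mul Spz.t))
  rw [pow_two]
  exact this.ne_zero (by norm_num)

theorem T_eig {T : Module.End KK (I → KK)} {i k : I} (hc : tL c d k * T = T * tL c d i) :
    ∃ y : KK, T (alphaK i) = y • alphaK k := by
  have h := LinearMap.congr_fun hc (alphaK i)
  simp only [Module.End.mul_apply, tL_apply, ph_self, map_sub, map_smul] at h
  have h2 : (1 + (qv ^ (-(d i)) * tv) ^ 2) • T (alphaK i) = ph c d k (T (alphaK i)) • alphaK k :=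
    (sub_right_injective h).symm
  refine ⟨(1 + (qv ^ (-(d i)) * tv) ^ 2)⁻¹ * ph c d k (T (alphaK i)), ?_⟩
  rw [mul_smul, ← h2, inv_smul_smul₀ (e_ne i)]

theorem T_scalar [Nonempty I] (H : CH c d r) {ww : List I} {istar : I → I}
    (hinv : Function.Involutive istar)
    (hmin : ∀ m, SS c m = SS c ww → ww.length ≤ m.length)
    (hs : ∀ i, SS c ww (alphaZ i) = - alphaZ (istar i)) :
    ∃ x : KK, ∀ i, TT c d ww (alphaK i) = x • alphaK (istar i) := by
  have hc := fun i => H.TT_w0_conj hmin (hs i)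
  choose y hy using fun i => T_eig (hc i)
  have hd : ∀ i, d (istar i) = d i := by
    intro i
    have := H.B_S ww (alphaZ i) (alphaZ i)
    rw [hs, map_neg, map_neg, LinearMap.neg_apply, neg_neg, H.Baa, H.Baa] at this
    omega
  have hcc : ∀ i j, c (istar i) (istar j) = c i j := by
    intro i j
    have := congrFun (LinearMap.congr_fun (H.SS_w0_conj (hs i)) (alphaZ j)) (istar i)
    simp only [Module.End.mul_apply, sL_apply, map_sub, map_smul, map_neg, hs, co_alpha] at this
    simp [alphaZ] at this
    linarith
  have hconst := H.const_of_adj y fun i j hij h0 => by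
    have hne : istar i ≠ istar j := fun h => hij (hinv.injective h)
    have h := congrFun (LinearMap.congr_fun (hc i) (alphaK j)) (istar i)
    simp only [Module.End.mul_apply, tL_apply, map_sub, map_smul, hy, ph_ne c d _ _ hij,
      ph_ne c d _ _ hne, hd, hcc] at h
    simp only [alphaK, Pi.sub_apply, Pi.smul_apply, Pi.single_eq_same, smul_eq_mul, mul_one,
      Pi.single_eq_of_ne hne, mul_zero, zero_sub] at h
    have hz : qv ^ (-(d i)) * tv * qint (-c i j) ≠ 0 :=
      mul_ne_zero (mul_ne_zero (zpow_ne_zero _ qv_ne) tv_ne) (qint_ne (neg_ne_zero.2 h0))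
    refine mul_left_cancel₀ hz ?_
    linear_combination -h
  obtain ⟨i0⟩ := ‹Nonempty I›
  exact ⟨y i0, fun i => by rw [hy, hconst i i0]⟩

theorem T_form {T : Module.End KK (I → KK)} {istar : I → I}
    (hinv : Function.Involutive istar) {x : KK}
    (hx : ∀ i, T (alphaK i) = x • alphaK (istar i)) :
    T = x • LinearMap.funLeft KK KK istar := by
  refine LinearMap.ext fun v => ?_
  rw [vecK_sum v, map_sum, map_sum]
  refine Finset.sum_congr rfl fun i _ => ?_
  rw [map_smul, map_smul, hx, LinearMap.smul_apply]
  congr 2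
  funext k
  simp only [alphaK, LinearMap.funLeft_apply, Pi.single_apply]
  congr 1
  exact propext ⟨fun h => by rw [h, hinv], fun h => by rw [← h, hinv]⟩

theorem inv_all (H : CH c d r) {ww : List I} {istar : I → I}
    (hinv : Function.Involutive istar)
    (hs : ∀ i, SS c ww (alphaZ i) = - alphaZ (istar i)) (v : I → ℤ) (hv : 0 ≤ v) :
    SS c ww.reverse v ≤ 0 := by
  have hr : ∀ i, SS c ww.reverse (alphaZ i) = - alphaZ (istar i) := by
    intro i
    apply H.SS_inj ww
    rw [H.SS_rev_apply', map_neg, hs, neg_neg, hinv]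
  rw [vec_sum v, map_sum]
  refine Finset.sum_nonpos fun i _ => ?_
  rw [map_smul, hr, smul_neg]
  exact neg_nonpos.2 (smul_nonneg (hv i) (alpha_nonneg _))

theorem main [Nonempty I] (H : CH c d r) {ww : List I} {istar : I → I}
    (hinv : Function.Involutive istar)
    (hmin : ∀ m, SS c m = SS c ww → ww.length ≤ m.length)
    (hs : ∀ i, SS c ww (alphaZ i) = - alphaZ (istar i))
    {θ : I → ℤ} (hθ : IsRt c θ) (hh : ∀ β, IsRt c β → β ≤ θ) (v : I → KK) :
    TT c d ww v = fun k => -(qv ^ (-(r + ∑ i, θ i * d i)) * tv ^ (1 + ∑ i, θ i)) * v (istar k) := by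
  classical
  obtain ⟨x, hx⟩ := H.T_scalar hinv hmin hs
  have hT := T_form hinv hx
  have hR := H.red_of_min ww hmin
  have hfil : ∀ v ∈ H.PhiP, SS c ww.reverse v ≤ 0 := fun v hv =>
    H.inv_all hinv hs v ((H.mem_PhiP v).1 hv).2
  have s1 := H.red_sum (fun v => Bz c d v v) (fun i v => H.B_s i v v) ww hR
  have s2 := H.red_sum (fun _ => 1) (fun i v => rfl) ww hR
  rw [Finset.filter_true_of_mem hfil] at s1 s2
  have tN := H.trace_N hθ hh
  have th := H.trace_h hθ hh
  rw [← s1] at tN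
  rw [← s2] at th
  set N := r + ∑ i, θ i * d i with hN
  set h := 1 + ∑ i, θ i with hh'
  set n := Fintype.card I with hn
  have hn0 : n ≠ 0 := Fintype.card_ne_zero
  have hP : (LinearMap.det (LinearMap.funLeft KK KK istar)) ^ 2 = 1 := by
    rw [pow_two, ← map_mul]
    have : LinearMap.funLeft KK KK istar * LinearMap.funLeft KK KK istar = 1 := by
      refine LinearMap.ext fun v => ?_
      funext k
      simp [LinearMap.funLeft_apply, hinv k]
    rw [this, map_one]
  have hd := det_TT H ww
  rw [hT, LinearMap.det_smul, mul_pow, hP, mul_one, Module.finrank_fintype_fun_eq_card, ← tN, ← th,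
    ← hn] at hd
  set z := qv ^ (-N) * tv ^ h with hz
  have hz0 : z ≠ 0 := mul_ne_zero (zpow_ne_zero _ qv_ne) (zpow_ne_zero _ tv_ne)
  have hzz : qv ^ (-((n : ℤ) * N)) * tv ^ ((n : ℤ) * h) = z ^ n := by
    rw [hz, mul_pow, ← zpow_natCast, ← zpow_natCast, ← zpow_mul, ← zpow_mul]
    congr 2 <;> ring
  rw [hzz, ← pow_mul, ← pow_mul, mul_comm n 2] at hd
  have hone : (x / z) ^ (2 * n) = 1 := by
    rw [div_pow, hd, div_self (pow_ne_zero _ hz0)]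
  have hsz : Spz z 1 := by
    have := (Spz.q.zpow (-N)).mul (Spz.t.zpow h)
    rwa [mul_one] at this
  have hsx : Spz x (-1) := by
    obtain ⟨i0⟩ := ‹Nonempty I›
    have := Spz.TTw H ww i0 (istar i0)
    rw [hx, hs] at this
    simpa [alphaK, alphaZ] using this
  have hxz : x = -z := by
    rcases root_unity hn0 hone with e | e
    · rw [div_eq_one_iff_eq hz0] at e
      rw [e] at hsx
      have := hsx.unique hsz
      norm_num at this
    · rw [div_eq_iff hz0] at e
      rw [e]; ring
  funext k
  rw [hT, hxz]
  simp [LinearMap.funLeft_apply]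

end CH
end fin
theorem statement_3
    {I : Type} [Fintype I] [DecidableEq I] [Nonempty I]
    (c : I → I → ℤ) (d : I → ℤ) (r : ℤ)
    -- `C` is a symmetrizable generalized Cartan matrix
    (hdiag : ∀ i, c i i = 2)
    (hoff : ∀ i j, i ≠ j → c i j ≤ 0)
    -- `(d_i)` are positive integers with gcd 1 symmetrizing `C`
    (hdpos : ∀ i, 0 < d i)
    (hgcd : Finset.univ.gcd d = 1)
    (hsymm : ∀ i j, d i * c i j = d j * c j i)
    -- each `d_i ∈ {1, r}` where `r = max_i d_i`
    (honer : ∀ i, d i = 1 ∨ d i = r)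
    (hrmax : ∀ i, d i ≤ r)
    (hrmem : ∃ i, d i = r)
    -- `d_i c_{ij} = -max(d_i, d_j)` whenever `i ≠ j` and `c_{ij} ≠ 0`
    (hbmax : ∀ i j, i ≠ j → c i j ≠ 0 → d i * c i j = -(max (d i) (d j)))
    -- `C` is indecomposable
    (hconn : ∀ i j : I, Relation.ReflTransGen (fun a b => a ≠ b ∧ c a b ≠ 0) i j)
    -- `C` is of finite type: the Weyl group is finite
    (hWfin : {w : (I → ℤ) → (I → ℤ) | memW c w}.Finite)
    -- `θ = Σ a_i α_i` is the highest root: `θ ∈ Φ` and `θ - β ∈ Q₊` for all `β ∈ Φ`;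
    -- then `h = 1 + Σ a_i` and `N = r + Σ a_i d_i = r h^∨`
    (θ : I → ℤ)
    (hθΦ : ∃ w, memW c w ∧ ∃ i, θ = w (alphaZ i))
    (hθhigh : ∀ β : I → ℤ, (∃ w, memW c w ∧ ∃ i, β = w (alphaZ i)) → ∀ k, β k ≤ θ k)
    -- `w₀` is the longest element: `w₀ ∈ W` with `w₀(α_i) ∈ -Q₊` for all `i`,
    -- and `i ↦ i^*` is the involution with `w₀(α_i) = -α_{i^*}`
    (w0 : (I → ℤ) → (I → ℤ))
    (hw0W : memW c w0)
    (hw0neg : ∀ i k, w0 (alphaZ i) k ≤ 0)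
    (istar : I → I)
    (hstar : ∀ i, w0 (alphaZ i) = -alphaZ (istar i))
    (hstarinv : Function.Involutive istar)
    -- `ww = (i₁, …, i_l)` is a reduced expression of `w₀`
    (ww : List I)
    (hred : (ww.map (sZ c)).foldr (· ∘ ·) id = w0)
    (hmin : ∀ vv : List I, (vv.map (sZ c)).foldr (· ∘ ·) id = w0 → ww.length ≤ vv.length)
    :
    ∀ lam : I → KK,
      ww.foldr (fun a acc => Trefl c d a acc) lam =
        fun k => -(qv ^ (-(r + ∑ i, θ i * d i)) * tv ^ (1 + ∑ i, θ i)) * lam (istar k)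
    := by
  have H : CH c d r := ⟨hdiag, hoff, hdpos, hsymm, honer, hrmax, hrmem, hbmax, hconn, hWfin⟩
  have hww : ⇑(SS c ww) = w0 := (SS_coe c ww).trans hred
  have hrt : ∀ β : I → ℤ, IsRt c β → ∃ w, memW c w ∧ ∃ i, β = w (alphaZ i) := by
    rintro β ⟨l, i, rfl⟩
    exact ⟨_, ⟨l, rfl⟩, i, by rw [SS_coe]⟩
  have hθ : IsRt c θ := by
    obtain ⟨w, ⟨l, rfl⟩, i, hi⟩ := hθΦ
    exact ⟨l, i, by rw [hi, SS_coe]⟩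
  intro lam
  rw [TT_foldr c d hdpos]
  refine H.main hstarinv (fun m hm => hmin m ?_) (fun i => ?_) hθ (fun β hβ => hθhigh β (hrt β hβ)) lam
  · rw [← SS_coe, hm, hww]
  · rw [hww, hstar]
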